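/- arXiv:1205.5985 — 4 statements merged into one kernel-verified Lean document; each statement's English description precedes it below -/
import Mathlib

section
/- Let R be a commutative Noetherian ring, let C be a semidualizing R-module, and let 0 → M' → M → M'' → 0 be an exact sequence of R-modules and R-homomorphisms such that M' and M are C-injective. Then M'' is C-injective. -/
/-!
Common definitions: semidualizing modules, `C`-injective modules and dimensions,
`G_C`-injective modules, Bass/Auslander classes, relative Cohen-Macaulayness,
Cohen-Macaulay and Gorenstein local rings, trivial extensions, ideal torsion.
-/

noncomputable section

open CategoryTheory TensorProduct

universe u

variable (R : Type u) [CommRing R]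

/-- An `R`-module `M` is `C`-injective if it is isomorphic to `Hom_R(C, I)`
for some injective `R`-module `I`. -/
def IsCInjective (C M : ModuleCat.{u} R) : Prop :=
  ∃ I : ModuleCat.{u} R, Module.Injective R I ∧ Nonempty (M ≃ₗ[R] (C →ₗ[R] I))

/-- `HasCoresDimLE R P n M` : the module `M` admits a coresolution of length at most `n`
by modules satisfying the property `P`. -/
def HasCoresDimLE (P : ModuleCat.{u} R → Prop) : ℕ → ModuleCat.{u} R → Prop
  | 0, M => Subsingleton M ∨ P M
  | n + 1, M => Subsingleton M ∨ ∃ (X : ModuleCat.{u} R) (f : M →ₗ[R] X),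
      P X ∧ Function.Injective f ∧
        HasCoresDimLE P n (ModuleCat.of R (X ⧸ LinearMap.range f))

/-- The coresolution dimension of `M` with respect to the class of modules satisfying `P`,
as an element of `ℕ∞` (`⊤` meaning no finite coresolution exists). -/
def coresDim (P : ModuleCat.{u} R → Prop) (M : ModuleCat.{u} R) : ℕ∞ :=
  sInf {d : ℕ∞ | ∃ n : ℕ, d = n ∧ HasCoresDimLE R P n M}

/-- The `C`-injective dimension of `M`. -/
def cinjDim (C M : ModuleCat.{u} R) : ℕ∞ :=
  coresDim R (IsCInjective R C) M

/-- The injective dimension of `M`. -/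
def injDim (M : ModuleCat.{u} R) : ℕ∞ :=
  coresDim R (fun N => Module.Injective R N) M

/-- A finitely generated `R`-module `C` is semidualizing if the natural map
`R → Hom_R(C,C)` is bijective and `Ext_R^i(C,C) = 0` for all `i ≥ 1`. -/
def IsSemidualizing (C : ModuleCat.{u} R) : Prop :=
  Module.Finite R C ∧ Function.Bijective (LinearMap.lsmul R C) ∧
    ∀ i : ℕ, 1 ≤ i →
      Subsingleton (((Ext R (ModuleCat.{u} R) i).obj (Opposite.op C)).obj C)

/-- A dualizing module is a semidualizing module of finite injective dimension. -/
def IsDualizing (C : ModuleCat.{u} R) : Prop :=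
  IsSemidualizing R C ∧ injDim R C ≠ ⊤

/-- A complete `I_C I`-resolution: an exact complex `Y` (with `d i : Y (i+1) → Y i`)
which stays exact after applying `Hom_R(I, -)` for every `C`-injective `I`, whose terms
in positive degrees are `C`-injective and whose terms in degrees `≤ 0` are injective. -/
structure CompleteICIResolution (C : ModuleCat.{u} R) where
  Y : ℤ → ModuleCat.{u} R
  d : (i : ℤ) → (Y (i + 1) →ₗ[R] Y i)
  exact : ∀ i : ℤ, Function.Exact (d (i + 1)) (d i)
  cinj_pos : ∀ i : ℤ, 0 < i → IsCInjective R C (Y i)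
  inj_nonpos : ∀ i : ℤ, i ≤ 0 → Module.Injective R (Y i)
  homExact : ∀ I : ModuleCat.{u} R, IsCInjective R C I → ∀ i : ℤ,
    Function.Exact (fun f : I →ₗ[R] Y (i + 1 + 1) => (d (i + 1)).comp f)
      (fun f : I →ₗ[R] Y (i + 1) => (d i).comp f)

/-- A module is `G_C`-injective if it is the kernel of the degree-`0` differential of some
complete `I_C I`-resolution. -/
def IsGCInjective (C M : ModuleCat.{u} R) : Prop :=
  ∃ res : CompleteICIResolution R C,
    Nonempty (M ≃ₗ[R] ↥(LinearMap.ker (res.d (-1))))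

/-- The `G_C`-injective dimension of `M`. -/
def gcinjDim (C M : ModuleCat.{u} R) : ℕ∞ :=
  coresDim R (IsGCInjective R C) M

/-- `M` is relative Cohen-Macaulay with respect to `a`: there is exactly one
non-vanishing local cohomology module of `M` with respect to `a`. -/
def IsRelativeCM (a : Ideal R) (M : ModuleCat.{u} R) : Prop :=
  ∃! n : ℕ, Nontrivial ((localCohomology a n).obj M)

/-- `M` is relative Cohen-Macaulay with respect to `a`, with (unique) non-vanishing
local cohomology in degree `n`. -/
def IsRelativeCMAt (a : Ideal R) (n : ℕ) (M : ModuleCat.{u} R) : Prop :=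
  Nontrivial ((localCohomology a n).obj M) ∧
    ∀ i : ℕ, i ≠ n → Subsingleton ((localCohomology a i).obj M)

/-- The cohomological dimension `cd(a, M)`: the largest `i` with `H_a^i(M) ≠ 0`. -/
def lcCohomDim (a : Ideal R) (M : ModuleCat.{u} R) : ℕ :=
  sSup {i : ℕ | Nontrivial ((localCohomology a i).obj M)}

/-- The grade `grade(a, M)`: the least `i` with `H_a^i(M) ≠ 0`. -/
def lcGrade (a : Ideal R) (M : ModuleCat.{u} R) : ℕ :=
  sInf {i : ℕ | Nontrivial ((localCohomology a i).obj M)}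

/-- A Noetherian local ring is Cohen-Macaulay iff `H_m^i(R) = 0` for all `i ≠ dim R`
(Grothendieck's characterization, taken here as the definition). -/
def IsCohenMacaulayLocalRing (S : Type u) [CommRing S] [IsLocalRing S] : Prop :=
  ∀ i : ℕ, (i : WithBot ℕ∞) ≠ ringKrullDim S →
    Subsingleton ((localCohomology (IsLocalRing.maximalIdeal S) i).obj (ModuleCat.of S S))

/-- A local ring is Gorenstein if it has finite injective dimension over itself. -/
def IsGorensteinLocalRing (S : Type u) [CommRing S] : Prop :=
  injDim S (ModuleCat.of S S) ≠ ⊤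

/-- The `a`-torsion submodule `Γ_a(M)` of `M`. -/
def idealTorsion (a : Ideal R) (M : Type u) [AddCommGroup M] [Module R M] :
    Submodule R M :=
  ⨆ n : ℕ, Submodule.torsionBySet R M ((a ^ n : Ideal R) : Set R)

/-- The Krull dimension of a module, `dim_S N = dim (S / ann_S N)`. -/
def moduleKrullDim (S : Type u) [CommRing S] (N : Type u) [AddCommGroup N] [Module S N] :
    WithBot ℕ∞ :=
  ringKrullDim (S ⧸ Module.annihilator S N)

/-- `ht_M(a) = inf { dim_{R_p} M_p  |  p ∈ Supp (M / a M) }`. -/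
def heightWRT (a : Ideal R) (M : Type u) [AddCommGroup M] [Module R M] : WithBot ℕ∞ :=
  ⨅ (p : PrimeSpectrum R) (_ : p ∈ Module.support R (M ⧸ (a • (⊤ : Submodule R M)))),
    moduleKrullDim (Localization.AtPrime p.asIdeal) (LocalizedModule p.asIdeal.primeCompl M)

/-- Membership in the Bass class `B_C(R)`. -/
def MemBassClass (C M : ModuleCat.{u} R) : Prop :=
  (∀ i : ℕ, 1 ≤ i →
      Subsingleton (((Ext R (ModuleCat.{u} R) i).obj (Opposite.op C)).obj M)) ∧
  (∀ i : ℕ, 1 ≤ i →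
      Subsingleton (((Tor (ModuleCat.{u} R) i).obj C).obj (ModuleCat.of R (C →ₗ[R] M)))) ∧
  Function.Bijective
    (TensorProduct.lift ((LinearMap.id : (C →ₗ[R] M) →ₗ[R] (C →ₗ[R] M)).flip))

/-- Membership in the Auslander class `A_C(R)`. -/
def MemAuslanderClass (C M : ModuleCat.{u} R) : Prop :=
  (∀ i : ℕ, 1 ≤ i →
      Subsingleton (((Tor (ModuleCat.{u} R) i).obj C).obj M)) ∧
  (∀ i : ℕ, 1 ≤ i →
      Subsingleton (((Ext R (ModuleCat.{u} R) i).obj (Opposite.op C)).obj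
        (ModuleCat.of R (↥C ⊗[R] ↥M)))) ∧
  Function.Bijective ((TensorProduct.mk R ↥C ↥M).flip)

/-- `HasResDimLE R P n M` : `M` admits a resolution of length at most `n`
by modules satisfying `P`. -/
def HasResDimLE (P : ModuleCat.{u} R → Prop) : ℕ → ModuleCat.{u} R → Prop
  | 0, M => Subsingleton M ∨ P M
  | n + 1, M => Subsingleton M ∨ ∃ (X : ModuleCat.{u} R) (f : X →ₗ[R] M),
      P X ∧ Function.Surjective f ∧
        HasResDimLE P n (ModuleCat.of R ↥(LinearMap.ker f))

/-- The projective dimension of `M`. -/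
def projDim (M : ModuleCat.{u} R) : ℕ∞ :=
  sInf {d : ℕ∞ | ∃ n : ℕ, d = n ∧ HasResDimLE R (fun N => Module.Projective R N) n M}

/-- The first projection of the trivial extension `R ⋉ C`, as a ring homomorphism. -/
def trivExtFst (C : Type u) [AddCommGroup C] [Module R C] [Module Rᵐᵒᵖ C]
    [IsCentralScalar R C] : TrivSqZeroExt R C →+* R where
  toFun := TrivSqZeroExt.fst
  map_one' := TrivSqZeroExt.fst_one (R := R) (M := C)
  map_mul' := TrivSqZeroExt.fst_mul
  map_zero' := TrivSqZeroExt.fst_zero (R := R) (M := C)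
  map_add' := TrivSqZeroExt.fst_add

/-- The ideal `a ⊕ C` of the trivial extension `R ⋉ C`. -/
def trivExtIdeal (a : Ideal R) (C : Type u) [AddCommGroup C] [Module R C] [Module Rᵐᵒᵖ C]
    [IsCentralScalar R C] : Ideal (TrivSqZeroExt R C) :=
  Ideal.comap (trivExtFst R C) a

/-- An `R`-module `M`, viewed as a module over the trivial extension `R ⋉ C` via the
natural surjection `R ⋉ C → R`. -/
def trivExtModuleCat (C : Type u) [AddCommGroup C] [Module R C] [Module Rᵐᵒᵖ C]
    [IsCentralScalar R C] (M : Type u) [AddCommGroup M] [Module R M] :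
    ModuleCat.{u} (TrivSqZeroExt R C) :=
  letI := Module.compHom M (trivExtFst R C)
  ModuleCat.of (TrivSqZeroExt R C) M

end

noncomputable section
open CategoryTheory TensorProduct

/-- A linear map vanishing on the kernel of a surjective linear map factors through it. -/
theorem LinearMap.exists_comp_eq_of_ker_le {R A B D : Type*} [Ring R]
    [AddCommGroup A] [Module R A] [AddCommGroup B] [Module R B] [AddCommGroup D] [Module R D]
    {p : A →ₗ[R] B} (hp : Function.Surjective p) {q : A →ₗ[R] D}
    (h : LinearMap.ker p ≤ LinearMap.ker q) : ∃ ψ : B →ₗ[R] D, ψ ∘ₗ p = q := by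
  refine ⟨(LinearMap.ker p).liftQ q h ∘ₗ (p.quotKerEquivOfSurjective hp).symm.toLinearMap, ?_⟩
  ext a
  have : (p.quotKerEquivOfSurjective hp).symm (p a) = (LinearMap.ker p).mkQ a := by
    rw [LinearEquiv.symm_apply_eq]
    rfl
  simp [this]

/-- A linear map to an injective module that vanishes on the kernel of an arbitrary linear map
factors through it. -/
theorem Module.Injective.exists_comp_eq_of_ker_le {R A B I : Type u} [Ring R]
    [AddCommGroup A] [Module R A] [AddCommGroup B] [Module R B] [AddCommGroup I] [Module R I]
    [Module.Injective R I] {p : A →ₗ[R] B} {q : A →ₗ[R] I}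
    (h : LinearMap.ker p ≤ LinearMap.ker q) : ∃ ψ : B →ₗ[R] I, ψ ∘ₗ p = q := by
  obtain ⟨ψ₀, hψ₀⟩ := LinearMap.exists_comp_eq_of_ker_le p.surjective_rangeRestrict
    (q := q) (by rwa [LinearMap.ker_rangeRestrict])
  obtain ⟨ψ, hψ⟩ := Module.Injective.extension_property R I _ _
    (LinearMap.range p).subtype Subtype.val_injective ψ₀
  refine ⟨ψ, ?_⟩
  rw [← hψ₀, ← hψ]
  rfl

/-- A direct summand of an injective module is injective. -/
theorem Module.Injective.of_leftInverse {R I J : Type u} [Ring R]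
    [AddCommGroup I] [Module R I] [AddCommGroup J] [Module R J] [Module.Injective R I]
    (i : J →ₗ[R] I) (p : I →ₗ[R] J) (h : Function.LeftInverse p i) : Module.Injective R J where
  out X Y _ _ _ _ f hf g := by
    obtain ⟨k, hk⟩ := Module.Injective.out f hf (i ∘ₗ g)
    exact ⟨p ∘ₗ k, fun x => by simp [hk, h (g x)]⟩

section HomothetyIso

variable {R C I : Type u} [CommRing R] [AddCommGroup C] [Module R C]
  [AddCommGroup I] [Module R I] {n : ℕ} {b : Fin n → C}

/-- If `C` is faithful and generated by `b`, evaluation `C ⊗ Hom(C, I) → I` is surjective for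
`I` injective. -/
theorem exists_sum_apply_eq [Module.Injective R I]
    (hC : Function.Injective (LinearMap.lsmul R C)) (hb : Submodule.span R (Set.range b) = ⊤)
    (x : I) : ∃ h : Fin n → (C →ₗ[R] I), ∑ i, h i (b i) = x := by
  have hker : LinearMap.ker (LinearMap.toSpanSingleton R (Fin n → C) b) ≤
      LinearMap.ker (LinearMap.toSpanSingleton R I x) := by
    intro r hr
    have hr0 : r = 0 := by
      apply hC
      rw [map_zero]
      refine LinearMap.ext_on_range hb fun i => ?_
      simpa using congrFun (LinearMap.mem_ker.mp hr) i
    simp [hr0]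
  obtain ⟨H, hH⟩ := Module.Injective.exists_comp_eq_of_ker_le hker
  refine ⟨fun i => H ∘ₗ LinearMap.single R (fun _ => C) i, ?_⟩
  have h1 := LinearMap.congr_fun hH 1
  simp only [LinearMap.comp_apply, LinearMap.toSpanSingleton_apply, one_smul] at h1
  simp only [LinearMap.comp_apply, LinearMap.coe_single]
  rw [← map_sum, Finset.univ_sum_single, h1]

/-- If the homothety map `R → Hom(C, C)` is surjective, `C` is generated by `b` and `I` is
injective, every element of the kernel of evaluation `C ⊗ Hom(C, I) → I` is explained by relations
among the generators `b`. -/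
theorem exists_relations_of_sum_apply_eq_zero [IsNoetherianRing R] [Module.Injective R I]
    (hC : Function.Surjective (LinearMap.lsmul R C)) (hb : Submodule.span R (Set.range b) = ⊤)
    (h : Fin n → (C →ₗ[R] I)) (hh : ∑ i, h i (b i) = 0) :
    ∃ (m : ℕ) (r : Fin m → Fin n → R) (y : Fin m → (C →ₗ[R] I)),
      (∀ j, ∑ i, r j i • b i = 0) ∧ ∀ i, h i = ∑ j, r j i • y j := by
  obtain ⟨m, r, hr⟩ := Submodule.fg_iff_exists_fin_generating_family.1
    (IsNoetherian.noetherian (LinearMap.ker (Fintype.linearCombination R b)))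
  have hbsurj : Function.Surjective (Fintype.linearCombination R b) := by
    rw [← LinearMap.range_eq_top, Fintype.range_linearCombination, hb]
  let T : (Fin n → C) →ₗ[R] (Fin m → C) :=
    LinearMap.pi fun j => ∑ i, r j i • LinearMap.proj i
  let H : (Fin n → C) →ₗ[R] I := ∑ i, h i ∘ₗ LinearMap.proj i
  have hker : LinearMap.ker T ≤ LinearMap.ker H := by
    intro x hx
    have hle : LinearMap.ker (Fintype.linearCombination R b) ≤
        LinearMap.ker (Fintype.linearCombination R x) := by
      rw [← hr, Submodule.span_le]
      rintro _ ⟨j, rfl⟩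
      simpa [T, Fintype.linearCombination_apply] using congrFun (LinearMap.mem_ker.mp hx) j
    obtain ⟨ψ, hψ⟩ := LinearMap.exists_comp_eq_of_ker_le hbsurj hle
    obtain ⟨s, rfl⟩ := hC ψ
    have hx' (i : Fin n) : x i = s • b i := by
      simpa [Fintype.linearCombination_apply_single] using
        (LinearMap.congr_fun hψ (Pi.single i 1)).symm
    simp [H, hx', ← Finset.smul_sum, hh]
  obtain ⟨y, hy⟩ := Module.Injective.exists_comp_eq_of_ker_le hker
  refine ⟨m, r, fun j => y ∘ₗ LinearMap.single R (fun _ => C) j, fun j => ?_, fun i => ?_⟩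
  · have : r j ∈ LinearMap.ker (Fintype.linearCombination R b) :=
      hr ▸ Submodule.subset_span ⟨j, rfl⟩
    simpa [Fintype.linearCombination_apply] using this
  · ext c
    have hTc : T (Pi.single i c) = ∑ j, Pi.single j (r j i • c) := by
      rw [Finset.univ_sum_single]
      ext j
      simp [T, Pi.single_apply]
    have hHc : H (Pi.single i c) = h i c := by
      simp only [H, LinearMap.sum_apply, LinearMap.comp_apply, LinearMap.proj_apply]
      rw [Finset.sum_eq_single i]
      · simp
      · intro k _ hk
        simp [hk]
      · simp
    rw [← hHc, ← hy, LinearMap.comp_apply, hTc, map_sum]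
    simp [Pi.single_smul]

/-- Under the homothety isomorphism, `Hom(C, -)` is full on injective modules. -/
theorem exists_forall_eq_comp [IsNoetherianRing R] [Module.Finite R C] {I' : Type u}
    [AddCommGroup I'] [Module R I'] [Module.Injective R I']
    (hC : Function.Bijective (LinearMap.lsmul R C)) (F : (C →ₗ[R] I') →ₗ[R] (C →ₗ[R] I)) :
    ∃ φ : I' →ₗ[R] I, ∀ h, F h = φ ∘ₗ h := by
  obtain ⟨n, b, hb⟩ := Module.Finite.exists_fin (R := R) (M := C)
  let ev (J : Type u) [AddCommGroup J] [Module R J] : (Fin n → (C →ₗ[R] J)) →ₗ[R] J :=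
    ∑ i, (LinearMap.applyₗ (b i)) ∘ₗ LinearMap.proj i
  have ev_apply (J : Type u) [AddCommGroup J] [Module R J] (h : Fin n → (C →ₗ[R] J)) :
      ev J h = ∑ i, h i (b i) := by simp [ev]
  have hsurj : Function.Surjective (ev I') := fun x => by
    obtain ⟨h, hh⟩ := exists_sum_apply_eq hC.1 hb x
    exact ⟨h, (ev_apply I' h).trans hh⟩
  have hker : LinearMap.ker (ev I') ≤ LinearMap.ker (ev I ∘ₗ F.compLeft (Fin n)) := by
    intro h hh
    obtain ⟨m, r, y, hr, hy⟩ := exists_relations_of_sum_apply_eq_zero hC.2 hb h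
      ((ev_apply I' h).symm.trans hh)
    have key : ∑ i, F (h i) (b i) = ∑ j, F (y j) (∑ i, r j i • b i) := by
      simp only [hy, map_sum, map_smul, LinearMap.sum_apply, LinearMap.smul_apply]
      exact Finset.sum_comm
    simpa [ev_apply, hr] using key
  obtain ⟨φ, hφ⟩ := LinearMap.exists_comp_eq_of_ker_le hsurj hker
  refine ⟨φ, fun h => LinearMap.ext_on_range hb fun i => ?_⟩
  have := LinearMap.congr_fun hφ (Pi.single i h)
  simp only [LinearMap.comp_apply, ev_apply, LinearMap.compLeft_apply] at this
  rw [Finset.sum_eq_single i (fun k _ hk => by simp [hk]) (by simp),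
    Finset.sum_eq_single i (fun k _ hk => by simp [hk]) (by simp)] at this
  simpa using this.symm

end HomothetyIso

/-- If `C` is finite and faithful over a Noetherian ring, then `Hom(C, -)` reflects injectivity
of linear maps. -/
theorem LinearMap.injective_of_injective_compRight {R C I' I : Type*} [CommRing R]
    [IsNoetherianRing R] [AddCommGroup C] [Module R C] [Module.Finite R C]
    [AddCommGroup I'] [Module R I'] [AddCommGroup I] [Module R I]
    (hC : Function.Injective (LinearMap.lsmul R C)) (φ : I' →ₗ[R] I)
    (hφ : ∀ h : C →ₗ[R] I', φ ∘ₗ h = 0 → h = 0) : Function.Injective φ := by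
  rw [injective_iff_map_eq_zero]
  intro x hx
  have hsub : Subsingleton (C →ₗ[R] (R ∙ x)) := by
    refine subsingleton_of_forall_eq 0 fun h => ?_
    have h0 : (R ∙ x).subtype ∘ₗ h = 0 := by
      refine hφ _ (LinearMap.ext fun c => ?_)
      obtain ⟨r, hr⟩ := Submodule.mem_span_singleton.mp (h c).2
      simp [← hr, hx]
    ext c
    simpa using LinearMap.congr_fun h0 c
  obtain ⟨r, hr, hreg⟩ := IsSMulRegular.subsingleton_linearMap_iff.mp hsub
  have hr0 : r = 0 := by
    apply hC
    ext c
    simpa using Module.mem_annihilator.mp hr c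
  have hx0 : (⟨x, Submodule.mem_span_singleton_self x⟩ : R ∙ x) = 0 :=
    hreg (by simp [hr0])
  simpa using congrArg Subtype.val hx0

/-- If `0 → M' → M → M'' → 0` is exact with `M'` and `M` `C`-injective,
then `M''` is `C`-injective. -/
theorem stmt_0 (R : Type u) [CommRing R] [IsNoetherianRing R]
    (C : ModuleCat.{u} R) (hC : IsSemidualizing R C)
    (M' M M'' : Type u) [AddCommGroup M'] [Module R M'] [AddCommGroup M] [Module R M]
    [AddCommGroup M''] [Module R M'']
    (f : M' →ₗ[R] M) (g : M →ₗ[R] M'')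
    (hf : Function.Injective f) (hg : Function.Surjective g) (hfg : Function.Exact f g)
    (hM' : IsCInjective R C (ModuleCat.of R M')) (hM : IsCInjective R C (ModuleCat.of R M)) :
    IsCInjective R C (ModuleCat.of R M'') := by
  obtain ⟨hfin, hbij, -⟩ := hC
  obtain ⟨I', hI', ⟨e'⟩⟩ := hM'
  obtain ⟨I, hI, ⟨e⟩⟩ := hM
  obtain ⟨φ, hφ⟩ := exists_forall_eq_comp hbij
    (e.toLinearMap ∘ₗ f ∘ₗ e'.symm.toLinearMap : (C →ₗ[R] I') →ₗ[R] (C →ₗ[R] I))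
  have hφinj : Function.Injective φ := by
    refine LinearMap.injective_of_injective_compRight hbij.1 φ fun h hh => ?_
    have h0 : e (f (e'.symm h)) = 0 := (hφ h).trans hh
    rw [LinearEquiv.map_eq_zero_iff, map_eq_zero_iff f hf] at h0
    exact e'.symm.map_eq_zero_iff.mp h0
  obtain ⟨ρ, hρ⟩ := Module.Injective.out φ hφinj LinearMap.id
  let π : I →ₗ[R] LinearMap.ker ρ :=
    (LinearMap.id - φ ∘ₗ ρ).codRestrict _ fun x => by simp [hρ]
  have hπ : Function.LeftInverse π (LinearMap.ker ρ).subtype := fun x => by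
    ext
    simp [π]
  let p : M →ₗ[R] (C →ₗ[R] LinearMap.ker ρ) := LinearMap.compRight R π ∘ₗ e.toLinearMap
  have hp : Function.Surjective p := fun k =>
    ⟨e.symm ((LinearMap.ker ρ).subtype ∘ₗ k), LinearMap.ext fun c => by
      simpa [p] using hπ (k c)⟩
  have hker : LinearMap.ker g = LinearMap.ker p := by
    ext x
    rw [hfg.linearMap_ker_eq, LinearMap.mem_range, LinearMap.mem_ker]
    constructor
    · rintro ⟨z, rfl⟩
      have hz : e (f z) = φ ∘ₗ e' z := by simpa using hφ (e' z)
      ext c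
      simp [p, hz, π, hρ]
    · intro hx
      have hx' : e x = φ ∘ₗ (ρ ∘ₗ e x) := by
        ext c
        simpa [p, π, sub_eq_zero] using congrArg Subtype.val (LinearMap.congr_fun hx c)
      refine ⟨e'.symm (ρ ∘ₗ e x), e.injective ?_⟩
      exact (hφ _).trans hx'.symm
  exact ⟨ModuleCat.of R (LinearMap.ker ρ), .of_leftInverse _ π hπ,
    ⟨(g.quotKerEquivOfSurjective hg).symm ≪≫ₗ Submodule.quotEquivOfEq _ _ hker ≪≫ₗ
      p.quotKerEquivOfSurjective hp⟩⟩

end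
end

section
/- Let R be a commutative Noetherian ring, a an ideal of R, N a finitely generated R-module, and I an injective R-module. Then the local cohomology modules H_a^i(Hom_R(N,I)) vanish for all i ≥ 1. In particular, if C is a semidualizing R-module, then every C-injective R-module is Γ_a-acyclic, so the local cohomology modules of any R-module with respect to a can be computed from a C-injective coresolution. -/
noncomputable section
open CategoryTheory TensorProduct

section ExtComparison

open Limits

variable {R : Type*} [Ring R] {C : Type*} [Category* C] [Abelian C] [Linear R C]
  [EnoughProjectives C]

theorem homologyMap_eq_zero_of_iCycles_comp {D ι : Type*} [Category* D] [Abelian D]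
    {c : ComplexShape ι} {K L : HomologicalComplex D c} (φ : K ⟶ L) (i : ι)
    (h : K.iCycles i ≫ φ.f i ≫ L.pOpcycles i = 0) :
    HomologicalComplex.homologyMap φ i = 0 := by
  rw [← cancel_epi (K.homologyπ i), ← cancel_mono (L.homologyι i)]
  simpa using h

/-- A morphism induces zero on `Ext` as soon as it carries cocycles to coboundaries, this being
tested on the derived-category model of `Ext`. -/
theorem ext_map_app_eq_zero [HasExt C] {X Y : C} (f : X ⟶ Y) (M : C) (n : ℕ)
    (h : ∀ x : Abelian.Ext Y M (n + 1), (Abelian.Ext.mk₀ f).comp x (zero_add _) = 0) :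
    ((Ext R C (n + 1)).map f.op).app M = 0 := by
  let P := projectiveResolution X
  let Q := projectiveResolution Y
  let g : P.complex ⟶ Q.complex := ProjectiveResolution.lift f P Q
  have hg := ProjectiveResolution.lift_commutes f P Q
  let F := ((linearYoneda R C).obj M).rightOp
  suffices key : (F.mapHomologicalComplex _ ⋙
      HomologicalComplex.homologyFunctor _ (ComplexShape.down ℕ) (n + 1)).map g = 0 by
    have h1 : (F.leftDerived (n + 1)).map f = 0 := by
      rw [F.leftDerived_map_eq (n + 1) f g hg, key]
      simp
    change ((F.leftDerived (n + 1)).map f).unop = 0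
    rw [h1]
    rfl
  refine homologyMap_eq_zero_of_iCycles_comp ((F.mapHomologicalComplex _).map g) (n + 1) ?_
  apply Quiver.Hom.unop_inj
  ext z
  let p := ((F.mapHomologicalComplex (ComplexShape.down ℕ)).obj Q.complex).pOpcycles (n + 1)
  let ι := ((F.mapHomologicalComplex (ComplexShape.down ℕ)).obj P.complex).iCycles (n + 1)
  let φ : Q.complex.X (n + 1) ⟶ M := p.unop z
  have hφ : Q.complex.d (n + 2) (n + 1) ≫ φ = 0 :=
    congrArg (fun k => k.unop z) (HomologicalComplex.d_pOpcycles
      ((F.mapHomologicalComplex (ComplexShape.down ℕ)).obj Q.complex) (n + 2) (n + 1))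
  let G : ProjectiveResolution.Hom P Q f := ⟨g, HomologicalComplex.congr_hom hg 0⟩
  have hx := h (Q.extMk φ (n + 2) rfl hφ)
  rw [ProjectiveResolution.mk₀_comp_extMk φ (n + 2) rfl hφ G,
    P.extMk_eq_zero_iff _ _ _ _ n rfl] at hx
  obtain ⟨χ, hχ⟩ := hx
  change ι.unop (g.f (n + 1) ≫ φ) = 0
  erw [← hχ]
  exact congrArg (fun k => k.unop χ) (HomologicalComplex.iCycles_d
    ((F.mapHomologicalComplex (ComplexShape.down ℕ)).obj P.complex) (n + 1) n)

end ExtComparison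

section LocalCohomologyVanishing

variable {R : Type u} [CommRing R]

/-- `H_a^i(M)` vanishes if the transition maps of `Ext^i(R/a^t, M)` are eventually zero. -/
theorem localCohomology_subsingleton_of_map_eq_zero (a : Ideal R) (i : ℕ) (M : ModuleCat.{u} R)
    (h : ∀ t : ℕ, ∃ s, ∃ hts : t ≤ s,
      ((localCohomology.diagram (localCohomology.idealPowersDiagram a) i).map
        (homOfLE hts).op.op).app M = 0) :
    Subsingleton ((localCohomology a i).obj M) := by
  apply ModuleCat.subsingleton_of_isZero
  rw [Limits.IsZero.iff_id_eq_zero]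
  let D := localCohomology.diagram (localCohomology.idealPowersDiagram a) i
  let E := (evaluation (ModuleCat.{u} R) (ModuleCat.{u} R)).obj M
  refine (Limits.isColimitOfPreserves E (Limits.colimit.isColimit D)).hom_ext fun j => ?_
  obtain ⟨s, hts, hs⟩ := h j.unop.unop
  have hw := (E.mapCocone (Limits.colimit.cocone D)).w (homOfLE hts).op.op
  refine Eq.trans ?_ Limits.comp_zero.symm
  refine (Category.comp_id _).trans ?_
  refine hw.symm.trans ?_
  exact (congrArg (· ≫ _) hs).trans Limits.zero_comp

/-- A linear map on a submodule `K` of `F` that kills `a^t • K` becomes extendable to `F` as a map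
killed by a higher power of `a`. -/
theorem exists_extension_killed_by_pow [IsNoetherianRing R] (a : Ideal R)
    {F : Type u} [AddCommGroup F] [Module R F] [Module.Finite R F] (K : Submodule R F) (t : ℕ) :
    ∃ s ≥ t, ∀ (I : Type u) [AddCommGroup I] [Module R I], Module.Injective R I →
      ∀ g : K →ₗ[R] I, (∀ r ∈ a ^ t, r • g = 0) →
        ∃ h : F →ₗ[R] I, h ∘ₗ K.subtype = g ∧ ∀ r ∈ a ^ s, r • h = 0 := by
  obtain ⟨k, hk⟩ := a.exists_pow_inf_eq_pow_smul K
  refine ⟨k + t, by lia, fun I _ _ hI g hg => ?_⟩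
  have hle : a ^ (k + t) • (⊤ : Submodule R F) ⊓ K ≤ (LinearMap.ker g).map K.subtype := by
    rw [hk (k + t) (by lia), Nat.add_sub_cancel_left, Submodule.smul_le]
    rintro r hr x ⟨-, hx⟩
    refine ⟨r • ⟨x, hx⟩, ?_, rfl⟩
    simpa [← map_smul] using LinearMap.congr_fun (hg r hr) ⟨x, hx⟩
  let p : K →ₗ[R] F ⧸ (a ^ (k + t) • (⊤ : Submodule R F)) := Submodule.mkQ _ ∘ₗ K.subtype
  have hp : LinearMap.ker p ≤ LinearMap.ker g := by
    intro x hx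
    obtain ⟨y, hy, hyx⟩ := hle ⟨(Submodule.Quotient.mk_eq_zero _).1 hx, x.2⟩
    rwa [← Subtype.ext hyx]
  obtain ⟨h, hh⟩ := Module.Injective.extension_property R I _ _ ((LinearMap.ker p).liftQ p le_rfl)
    (LinearMap.ker_eq_bot.1 (Submodule.ker_liftQ_eq_bot _ _ _ le_rfl))
    ((LinearMap.ker p).liftQ g hp)
  refine ⟨h ∘ₗ Submodule.mkQ _, ?_, fun r hr => ?_⟩
  · ext x
    exact LinearMap.congr_fun hh (Submodule.Quotient.mk x)
  · ext x
    have : (Submodule.Quotient.mk (r • x) : F ⧸ (a ^ (k + t) • (⊤ : Submodule R F))) = 0 :=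
      (Submodule.Quotient.mk_eq_zero _).2 (Submodule.smul_mem_smul hr trivial)
    simpa using congrArg h this

theorem injective_linearMap_fin_fun (n : ℕ) (I : Type u) [AddCommGroup I] [Module R I]
    (hI : Module.Injective R I) : Injective (ModuleCat.of R ((Fin n → R) →ₗ[R] I)) :=
  have := Module.injective_object_of_injective_module R (Fin n → I)
  Injective.of_iso (LinearEquiv.piRing R I (Fin n) R).symm.toModuleIso this

section DimensionShift

open Abelian

variable {C : Type*} [Category* C] [Abelian C] [HasExt C] {S : ShortComplex C}

theorem CategoryTheory.ShortComplex.ShortExact.mk₀_comp_ext_succ_eq_zero (hS : S.ShortExact)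
    [Injective S.X₂] {X Y : C} (f : X ⟶ Y) (n : ℕ)
    (h : ∀ y : Ext Y S.X₃ n, (Ext.mk₀ f).comp y (zero_add _) = 0) (x : Ext Y S.X₁ (n + 1)) :
    (Ext.mk₀ f).comp x (zero_add _) = 0 := by
  obtain ⟨y, rfl⟩ := Ext.covariant_sequence_exact₁ _ hS x (Ext.eq_zero_of_injective _) rfl
  rw [← Ext.comp_assoc _ _ _ (zero_add n) rfl (by lia), h, Ext.zero_comp]

theorem CategoryTheory.ShortComplex.ShortExact.mk₀_comp_ext_one_eq_zero (hS : S.ShortExact)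
    [Injective S.X₂] {X Y : C} (f : X ⟶ Y)
    (h : ∀ φ : Y ⟶ S.X₃, ∃ ψ : X ⟶ S.X₂, f ≫ φ = ψ ≫ S.g) (x : Ext Y S.X₁ 1) :
    (Ext.mk₀ f).comp x (zero_add _) = 0 := by
  obtain ⟨y, rfl⟩ := Ext.covariant_sequence_exact₁ _ hS x (Ext.eq_zero_of_injective _) (zero_add 1)
  obtain ⟨φ, rfl⟩ := (Ext.mk₀_bijective _ _).2 y
  obtain ⟨ψ, hψ⟩ := h φ
  rw [← Ext.comp_assoc _ _ _ (zero_add 0) (zero_add 1) (by lia), Ext.mk₀_comp_mk₀, hψ,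
    ← Ext.mk₀_comp_mk₀, Ext.comp_assoc _ _ _ (zero_add 0) (zero_add 1) (by lia),
    hS.comp_extClass, Ext.comp_zero]

end DimensionShift

/-- The sequence `0 → Hom(N, I) → Hom(F, I) → Hom(K, I) → 0` attached to a presentation
`0 → K → F → N → 0`. -/
def homShortComplex {F N : Type u} [AddCommGroup F] [Module R F] [AddCommGroup N] [Module R N]
    (q : F →ₗ[R] N) (I : Type u) [AddCommGroup I] [Module R I] : ShortComplex (ModuleCat.{u} R) where
  X₁ := ModuleCat.of R (N →ₗ[R] I)
  X₂ := ModuleCat.of R (F →ₗ[R] I)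
  X₃ := ModuleCat.of R (LinearMap.ker q →ₗ[R] I)
  f := ModuleCat.ofHom (LinearMap.lcomp R I q)
  g := ModuleCat.ofHom (LinearMap.lcomp R I (LinearMap.ker q).subtype)
  zero := by
    ext f x
    simp

theorem homShortComplex_shortExact {F N : Type u} [AddCommGroup F] [Module R F]
    [AddCommGroup N] [Module R N] (q : F →ₗ[R] N) (hq : Function.Surjective q)
    (I : Type u) [AddCommGroup I] [Module R I] (hI : Module.Injective R I) :
    (homShortComplex q I).ShortExact where
  exact := by
    rw [ShortComplex.moduleCat_exact_iff]
    intro (f : F →ₗ[R] I) hf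
    have hf' : LinearMap.ker q ≤ LinearMap.ker f := fun x hx =>
      LinearMap.congr_fun hf ⟨x, hx⟩
    refine ⟨(LinearMap.ker q).liftQ f hf' ∘ₗ (q.quotKerEquivOfSurjective hq).symm, ?_⟩
    refine LinearMap.ext fun x => ?_
    have : (q.quotKerEquivOfSurjective hq).symm (q x) = Submodule.Quotient.mk x := by
      rw [LinearEquiv.symm_apply_eq]; rfl
    change (LinearMap.ker q).liftQ f hf' ((q.quotKerEquivOfSurjective hq).symm (q x)) = f x
    rw [this]; rfl
  mono_f := (ModuleCat.mono_iff_injective _).2 <| LinearMap.lcomp_injective_of_surjective q hq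
  epi_g := (ModuleCat.epi_iff_surjective _).2 fun g =>
    Module.Injective.extension_property R I _ _ _ (LinearMap.ker q).subtype_injective g

open Abelian in
/-- For `N` finitely generated and `I` injective, the inverse system of the `R/a^t` becomes
essentially zero on positive `Ext` with values in `Hom(N, I)`. -/
theorem exists_ext_map_eq_zero [IsNoetherianRing R] (a : Ideal R) (I : Type u) [AddCommGroup I]
    [Module R I] (hI : Module.Injective R I) (n t : ℕ) (N : Type u) [AddCommGroup N] [Module R N]
    [Module.Finite R N] :
    ∃ s, ∃ hts : t ≤ s, ∀ x : Ext (ModuleCat.of R (R ⧸ a ^ t)) (ModuleCat.of R (N →ₗ[R] I)) (n + 1),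
      (Ext.mk₀ ((localCohomology.ringModIdeals (localCohomology.idealPowersDiagram a)).map
        (homOfLE hts).op)).comp x (zero_add _) = 0 := by
  induction n generalizing N with
  | zero =>
    obtain ⟨m, q, hq⟩ := Module.Finite.exists_fin' R N
    have hS := homShortComplex_shortExact q hq I hI
    have : Injective (homShortComplex q I).X₂ := injective_linearMap_fin_fun m I hI
    obtain ⟨s, hts, hs⟩ := exists_extension_killed_by_pow a (LinearMap.ker q) t
    refine ⟨s, hts, hS.mk₀_comp_ext_one_eq_zero _ fun φ => ?_⟩
    let φ' : (R ⧸ a ^ t) →ₗ[R] (LinearMap.ker q →ₗ[R] I) := φ.hom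
    obtain ⟨h, hh, hk⟩ := hs I hI (φ' (Submodule.Quotient.mk 1)) fun r hr => by
      rw [← map_smul, ← Submodule.Quotient.mk_smul, (Submodule.Quotient.mk_eq_zero _).2 (by simpa),
        map_zero]
    let ψ : ModuleCat.of R (R ⧸ a ^ s) ⟶ (homShortComplex q I).X₂ :=
      ModuleCat.ofHom ((a ^ s).liftQ (LinearMap.toSpanSingleton R _ h) hk)
    refine ⟨ψ, ?_⟩
    apply ModuleCat.hom_ext
    apply Submodule.linearMap_qext
    apply LinearMap.ext_ring
    change φ' (Submodule.Quotient.mk 1) = ((1 : R) • h) ∘ₗ (LinearMap.ker q).subtype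
    rw [one_smul, hh]
  | succ n ih =>
    obtain ⟨m, q, hq⟩ := Module.Finite.exists_fin' R N
    have hS := homShortComplex_shortExact q hq I hI
    have : Injective (homShortComplex q I).X₂ := injective_linearMap_fin_fun m I hI
    obtain ⟨s, hts, hs⟩ := ih (LinearMap.ker q)
    exact ⟨s, hts, hS.mk₀_comp_ext_succ_eq_zero _ _ hs⟩

theorem localCohomology_linearMap_subsingleton [IsNoetherianRing R] (a : Ideal R) (N : Type u)
    [AddCommGroup N] [Module R N] [Module.Finite R N] (I : Type u) [AddCommGroup I] [Module R I]
    (hI : Module.Injective R I) (i : ℕ) (hi : 1 ≤ i) :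
    Subsingleton ((localCohomology a i).obj (ModuleCat.of R (N →ₗ[R] I))) := by
  obtain ⟨n, rfl⟩ := Nat.exists_eq_add_of_le' hi
  refine localCohomology_subsingleton_of_map_eq_zero a _ _ fun t => ?_
  obtain ⟨s, hts, hs⟩ := exists_ext_map_eq_zero a I hI n t N
  exact ⟨s, hts, ext_map_app_eq_zero _ _ n hs⟩

end LocalCohomologyVanishing

/-- `H_a^i(Hom_R(N,I)) = 0` for `i ≥ 1` when `N` is finitely generated and
`I` is injective; in particular, for a semidualizing module `C`, every `C`-injective module
is `Γ_a`-acyclic. -/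
theorem stmt_2 (R : Type u) [CommRing R] [IsNoetherianRing R] (a : Ideal R)
    (N : Type u) [AddCommGroup N] [Module R N] [Module.Finite R N]
    (I : Type u) [AddCommGroup I] [Module R I] (hI : Module.Injective R I) :
    (∀ i : ℕ, 1 ≤ i →
      Subsingleton ((localCohomology a i).obj (ModuleCat.of R (N →ₗ[R] I)))) ∧
    (∀ C : ModuleCat.{u} R, IsSemidualizing R C →
      ∀ M : ModuleCat.{u} R, IsCInjective R C M →
        ∀ i : ℕ, 1 ≤ i → Subsingleton ((localCohomology a i).obj M)) := by
  refine ⟨localCohomology_linearMap_subsingleton a N I hI, ?_⟩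
  rintro C ⟨hC, -⟩ M ⟨J, hJ, ⟨e⟩⟩ i hi
  have := localCohomology_linearMap_subsingleton a C J hJ i hi
  exact ((localCohomology a i).mapIso e.toModuleIso).toLinearEquiv.toEquiv.subsingleton

end
end

section
/- Let (R,m) be a Noetherian local ring and let C be a semidualizing R-module. Then the support of C is all of Spec(R); moreover, for any ideal a of R, the cohomological dimension cd(a,C) equals cd(a,R) and the grade grade(a,C) equals grade(a,R). Consequently, if R is relative Cohen-Macaulay with respect to a, then so is C. -/
noncomputable section
open CategoryTheory Abelian Limits
universe u
namespace LocCohExt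

section Comparison
open CochainComplex HomComplex
variable {R : Type u} [CommRing R] {X X' Y : ModuleCat.{u} R}

abbrev homComplex (P : ProjectiveResolution X) (Y : ModuleCat.{u} R) :=
  P.complex.linearYonedaObj R Y

/-- The morphism underlying a cycle of the `Hom` complex. -/
def cocycle (P : ProjectiveResolution X) (n : ℕ) (z : (homComplex P Y).cycles n) :
    P.complex.X n ⟶ Y :=
  (homComplex P Y).iCycles n z

theorem d_comp_cocycle (P : ProjectiveResolution X) (n : ℕ)
    (z : (homComplex P Y).cycles n) :
    P.complex.d (n + 1) n ≫ cocycle P n z = 0 := by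
  have := (homComplex P Y).iCycles_d n (n + 1)
  exact congrArg (fun φ => φ.hom z) this

theorem exists_cycle (P : ProjectiveResolution X) (n : ℕ)
    (f : P.complex.X n ⟶ Y) (hf : P.complex.d (n + 1) n ≫ f = 0) :
    ∃ z : (homComplex P Y).cycles n, cocycle P n z = f := by
  refine ⟨(homComplex P Y).cyclesMk (i := n) f (n + 1) (by simp) hf, ?_⟩
  exact (homComplex P Y).i_cyclesMk (i := n) f (n + 1) (by simp) hf

theorem homologyπ_eq_zero_iff (P : ProjectiveResolution X) (n : ℕ)
    (z : (homComplex P Y).cycles n) :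
    (homComplex P Y).homologyπ n z = 0 ↔ ∃ g : P.complex.X (n - 1) ⟶ Y,
      P.complex.d n (n - 1) ≫ g = cocycle P n z := by
  have hi : (ComplexShape.up ℕ).prev n = n - 1 := by cases n <;> simp
  have hcok := (homComplex P Y).homologyIsCokernel (n - 1) n hi
  have hex := ShortComplex.exact_of_g_is_cokernel
    (ShortComplex.mk ((homComplex P Y).toCycles (n - 1) n) ((homComplex P Y).homologyπ n) (by simp)) hcok
  rw [ShortComplex.moduleCat_exact_iff] at hex
  have hto := (homComplex P Y).toCycles_i (n - 1) n
  constructor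
  · intro h
    obtain ⟨g, hg⟩ := hex z h
    refine ⟨g, ?_⟩
    have := congrArg (fun φ => φ.hom g) hto
    have h2 : cocycle P n z = ((homComplex P Y).d (n - 1) n).hom g := by
      rw [← this, ← hg]; rfl
    rw [h2]; rfl
  · rintro ⟨g, hg⟩
    have h1 : (homComplex P Y).toCycles (n - 1) n g = z := by
      apply (ModuleCat.mono_iff_injective ((homComplex P Y).iCycles n)).1 inferInstance
      refine Eq.trans ?_ hg
      exact congrArg (fun φ => φ.hom g) hto
    rw [← h1]
    exact congrArg (fun φ => φ.hom g) ((homComplex P Y).toCycles_comp_homologyπ (n - 1) n)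

theorem extMk_eq_zero_iff (P : ProjectiveResolution X) (n : ℕ)
    (f : P.complex.X n ⟶ Y) (hf : P.complex.d (n + 1) n ≫ f = 0) :
    P.extMk f (n + 1) rfl hf = 0 ↔ ∃ g : P.complex.X (n - 1) ⟶ Y, P.complex.d n (n - 1) ≫ g = f := by
  cases n with
  | succ n => exact P.extMk_eq_zero_iff f _ rfl hf n rfl
  | zero =>
    have hd : P.complex.d 0 (0 - 1) = 0 := P.complex.shape _ _ (by simp)
    simp only [← P.extEquivCohomologyClass.apply_eq_iff_eq,
      ProjectiveResolution.extEquivCohomologyClass_extMk, ProjectiveResolution.extEquivCohomologyClass_zero,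
      CohomologyClass.mk_eq_zero_iff]
    rw [Cocycle.toSingleMk_mem_coboundaries_iff _ _ _ _ _ 1 (by lia)]
    have hz : P.cochainComplex.d (-((0 : ℕ) : ℤ)) 1 = 0 := by
      apply IsZero.eq_of_tgt
      exact P.cochainComplex.isZero_of_isStrictlyLE 0 1 (by lia)
    rw [hz, hd]
    simp only [zero_comp, exists_const]
    refine ⟨fun h => ?_, fun h => ?_⟩
    · rw [← cancel_epi (P.cochainComplexXIso (-(0 : ℕ) : ℤ) 0 rfl).hom, comp_zero]
      exact h
    · rw [← h, comp_zero]

def cls (P : ProjectiveResolution X) (n : ℕ) (z : (homComplex P Y).cycles n) :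
    ((Ext R (ModuleCat.{u} R) n).obj (Opposite.op X)).obj Y :=
  (P.isoExt n Y).inv ((homComplex P Y).homologyπ n z)

theorem cls_eq_zero_iff (P : ProjectiveResolution X) (n : ℕ) (z : (homComplex P Y).cycles n) :
    cls P n z = 0 ↔ (homComplex P Y).homologyπ n z = 0 := by
  have := (ModuleCat.mono_iff_injective (P.isoExt (R := R) n Y).inv).1 inferInstance
  unfold cls
  rw [← map_zero (P.isoExt (R := R) n Y).inv.hom]
  exact this.eq_iff

theorem cls_surjective (P : ProjectiveResolution X) (n : ℕ) :
    Function.Surjective (cls (Y := Y) P n) := by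
  have h1 := (ModuleCat.epi_iff_surjective (P.isoExt (R := R) n Y).inv).1 inferInstance
  have h2 := (ModuleCat.epi_iff_surjective ((homComplex P Y).homologyπ n)).1 inferInstance
  exact h1.comp h2

/-- A lift of resolutions induces a map on `Hom` complexes. -/
def homComplexMap (P : ProjectiveResolution X) (P' : ProjectiveResolution X')
    (φ : P'.complex ⟶ P.complex) (Y : ModuleCat.{u} R) : homComplex P Y ⟶ homComplex P' Y :=
  (HomologicalComplex.unopFunctor _ _).map
    ((((linearYoneda R _).obj Y).rightOp.mapHomologicalComplex _).map φ).op

theorem comp_comp_eq_of_comm {𝒞 : Type*} [Category 𝒞] {A B D A' B' D' : 𝒞} {u : A ⟶ B} {v : B ⟶ D}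
    {u' : A' ⟶ B'} {v' : B' ⟶ D'} {h : A ⟶ A'} {N : B ⟶ B'} {M : D ⟶ D'}
    (h₁ : u ≫ N = h ≫ u') (h₂ : v ≫ M = N ≫ v') : (u ≫ v) ≫ M = h ≫ u' ≫ v' := by
  rw [Category.assoc, h₂, ← Category.assoc, h₁, Category.assoc]

theorem map_cls (P : ProjectiveResolution X) (P' : ProjectiveResolution X') {g : X' ⟶ X}
    (φ : ProjectiveResolution.Hom P' P g) (n : ℕ) (z : (homComplex P Y).cycles n) :
    ((Ext R (ModuleCat.{u} R) n).map g.op).app Y (cls P n z) =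
      cls P' n (HomologicalComplex.cyclesMap (homComplexMap P P' φ.hom Y) n z) := by
  have key : (P.isoExt (R := R) n Y).inv ≫ ((Ext R (ModuleCat.{u} R) n).map g.op).app Y =
      HomologicalComplex.homologyMap (homComplexMap P P' φ.hom Y) n ≫ (P'.isoExt n Y).inv := by
    have h1 := ProjectiveResolution.isoLeftDerivedObj_hom_naturality g P' P φ.hom
      (by simpa using φ.hom_f_zero_comp_π_f_zero) (((linearYoneda R _).obj Y).rightOp) n
    have h2 := HomologicalComplex.homologyOp_hom_naturality (homComplexMap P P' φ.hom Y) n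
    let F := ((linearYoneda R (ModuleCat.{u} R)).obj Y).rightOp
    let u := (HomologicalComplex.homologyOp (homComplex P Y) n).hom.unop
    let u' := (HomologicalComplex.homologyOp (homComplex P' Y) n).hom.unop
    let v := (P.isoLeftDerivedObj F n).hom.unop
    let v' := (P'.isoLeftDerivedObj F n).hom.unop
    let N := ((F.mapHomologicalComplex (ComplexShape.down ℕ) ⋙
      HomologicalComplex.homologyFunctor (ModuleCat.{u} R)ᵒᵖ (ComplexShape.down ℕ) n).map φ.hom).unop
    let M := ((F.leftDerived n).map g).unop
    have e3 : u ≫ N = HomologicalComplex.homologyMap (homComplexMap P P' φ.hom Y) n ≫ u' :=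
      congrArg Quiver.Hom.unop h2
    have e4 : v ≫ M = N ≫ v' := congrArg Quiver.Hom.unop h1
    exact comp_comp_eq_of_comm e3 e4
  have h3 := congrArg (fun ψ => ψ.hom ((homComplex P Y).homologyπ n z)) key
  refine h3.trans ?_
  have h4 := congrArg (fun ψ => ψ.hom z) (HomologicalComplex.homologyπ_naturality (homComplexMap P P' φ.hom Y) n)
  exact congrArg (P'.isoExt n Y).inv h4

theorem cocycle_cyclesMap (P : ProjectiveResolution X) (P' : ProjectiveResolution X')
    (φ : P'.complex ⟶ P.complex) (n : ℕ) (z : (homComplex P Y).cycles n) :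
    cocycle P' n (HomologicalComplex.cyclesMap (homComplexMap P P' φ Y) n z) =
      φ.f n ≫ cocycle P n z :=
  congrArg (fun ψ => ψ.hom z) (HomologicalComplex.cyclesMap_i (homComplexMap P P' φ Y) n)

/-- The comparison, at the level of vanishing, between the two versions of `Ext`. -/
theorem forall_exists_map_eq_zero_iff (X : ModuleCat.{u} R) (n : ℕ) (Y : ModuleCat.{u} R)
    {ι : Type*} (X' : ι → ModuleCat.{u} R) (g : ∀ i, X' i ⟶ X) :
    (∀ e : ((Ext R (ModuleCat.{u} R) n).obj (Opposite.op X)).obj Y,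
      ∃ i, ((Ext R (ModuleCat.{u} R) n).map (g i).op).app Y e = 0) ↔
    ∀ e : Abelian.Ext X Y n, ∃ i, (Abelian.Ext.mk₀ (g i)).comp e (zero_add n) = 0 := by
  let P := projectiveResolution X
  let P' := fun i => projectiveResolution (X' i)
  let φ : ∀ i, ProjectiveResolution.Hom (P' i) P (g i) := fun i =>
    { hom := ProjectiveResolution.lift (g i) _ _
      hom_f_zero_comp_π_f_zero := by
        rw [← HomologicalComplex.comp_f, ProjectiveResolution.lift_commutes]
        rfl }
  have key (z : (homComplex P Y).cycles n) (i : ι) :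
      ((Ext R (ModuleCat.{u} R) n).map (g i).op).app Y (cls P n z) = 0 ↔
      (Abelian.Ext.mk₀ (g i)).comp (P.extMk (cocycle P n z) (n + 1) rfl (d_comp_cocycle P n z))
        (zero_add n) = 0 := by
    rw [map_cls P (P' i) (φ i), cls_eq_zero_iff, homologyπ_eq_zero_iff, cocycle_cyclesMap,
      ProjectiveResolution.mk₀_comp_extMk _ _ _ _ (φ i), extMk_eq_zero_iff]
  constructor
  · intro h e
    obtain ⟨f, hf, rfl⟩ := P.extMk_surjective e (n + 1) rfl
    obtain ⟨z, rfl⟩ := exists_cycle P n f hf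
    obtain ⟨i, hi⟩ := h (cls P n z)
    exact ⟨i, (key z i).1 hi⟩
  · intro h e
    obtain ⟨z, rfl⟩ := cls_surjective P n e
    obtain ⟨i, hi⟩ := h (P.extMk (cocycle P n z) (n + 1) rfl (d_comp_cocycle P n z))
    exact ⟨i, (key z i).2 hi⟩

theorem subsingleton_iff (X Y : ModuleCat.{u} R) (n : ℕ) :
    Subsingleton (((Ext R (ModuleCat.{u} R) n).obj (Opposite.op X)).obj Y) ↔
      Subsingleton (Abelian.Ext X Y n) := by
  have := forall_exists_map_eq_zero_iff X n Y (fun _ : Unit => X) (fun _ => 𝟙 X)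
  have hid (e : ((Ext R (ModuleCat.{u} R) n).obj (Opposite.op X)).obj Y) :
      ((Ext R (ModuleCat.{u} R) n).map (𝟙 X).op).app Y e = e :=
    congrArg (fun α => (α.app Y).hom e) ((Ext R (ModuleCat.{u} R) n).map_id _)
  simp only [hid, Abelian.Ext.mk₀_id_comp, exists_const] at this
  rw [subsingleton_iff_forall_eq 0, subsingleton_iff_forall_eq 0]
  exact this

end Comparison

variable {R : Type u} [CommRing R]

/-- The module `R / a ^ t`. -/
abbrev powQuot (a : Ideal R) (t : ℕ) : ModuleCat.{u} R := ModuleCat.of R (R ⧸ a ^ t)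

/-- The projection `R / a ^ s → R / a ^ t` for `t ≤ s`. -/
def powQuotMap (a : Ideal R) {t s : ℕ} (h : t ≤ s) : powQuot a s ⟶ powQuot a t :=
  ModuleCat.ofHom (Submodule.mapQ _ _ LinearMap.id (Ideal.pow_le_pow_right h))

theorem subsingleton_colimit_iff {J : Type} [SmallCategory J] [IsFiltered J]
    (F : J ⥤ ModuleCat.{u} R) :
    Subsingleton (colimit F : ModuleCat.{u} R) ↔ ∀ (j : J) (x : F.obj j), ∃ (k : J) (f : j ⟶ k), F.map f x = 0 := by
  have : PreservesFilteredColimitsOfSize.{0, 0} (forget (ModuleCat.{u} R)) :=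
    preservesFilteredColimitsOfSize_shrink.{0, u, 0, u} _
  rw [subsingleton_iff_forall_eq 0]
  constructor
  · intro h j x
    obtain ⟨k, f, hf⟩ := Concrete.colimit_rep_eq_zero R F j x (h _)
    exact ⟨k, f, hf⟩
  · intro h y
    obtain ⟨j, x, rfl⟩ := Concrete.colimit_exists_rep F y
    obtain ⟨k, f, hf⟩ := h j x
    have h2 := congrArg (fun φ => φ.hom x) (colimit.w F f)
    refine h2.symm.trans ?_
    change colimit.ι F k (F.map f x) = 0
    rw [hf]
    exact map_zero _

@[simp]
theorem powQuotMap_comp (a : Ideal R) {t s r : ℕ} (h : t ≤ s) (h' : s ≤ r) :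
    powQuotMap a h' ≫ powQuotMap a h = powQuotMap a (h.trans h') := by
  ext
  rfl

/-- Restriction of a class along `R / a ^ s → R / a ^ t`. -/
def res (a : Ideal R) {t s : ℕ} (h : t ≤ s) {M : ModuleCat.{u} R} {i : ℕ}
    (e : Ext (powQuot a t) M i) : Ext (powQuot a s) M i :=
  (Ext.mk₀ (powQuotMap a h)).comp e (zero_add i)

theorem res_res (a : Ideal R) {t s r : ℕ} (h : t ≤ s) (h' : s ≤ r) {M : ModuleCat.{u} R} {i : ℕ}
    (e : Ext (powQuot a t) M i) : res a h' (res a h e) = res a (h.trans h') e := by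
  simp [res, Ext.mk₀_comp_mk₀_assoc]

@[simp]
theorem res_zero (a : Ideal R) {t s : ℕ} (h : t ≤ s) {M : ModuleCat.{u} R} {i : ℕ} :
    res a h (0 : Ext (powQuot a t) M i) = 0 := by
  simp [res]

theorem res_comp (a : Ideal R) {t s : ℕ} (h : t ≤ s) {M N : ModuleCat.{u} R} {i j k : ℕ}
    (e : Ext (powQuot a t) M i) (f : Ext M N j) (hk : i + j = k) :
    res a h (e.comp f hk) = (res a h e).comp f hk := by
  unfold res
  rw [Ext.comp_assoc _ _ _ (zero_add i) hk (by omega)]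

/-- The `i`-th local cohomology of `M` vanishes, phrased via Ext groups. -/
def LocCohVanishes (a : Ideal R) (M : Type u) [AddCommGroup M] [Module R M] (i : ℕ) : Prop :=
  ∀ (t : ℕ) (e : Ext (powQuot a t) (ModuleCat.of R M) i),
    ∃ (s : ℕ) (h : t ≤ s), res a h e = 0

theorem subsingleton_localCohomology_iff (a : Ideal R) (M : ModuleCat.{u} R) (i : ℕ) :
    Subsingleton ((localCohomology a i).obj M) ↔ LocCohVanishes a M i := by
  let F := localCohomology.diagram (localCohomology.idealPowersDiagram a) i
  let e : (localCohomology a i).obj M ≅ colimit (F ⋙ (evaluation _ _).obj M) :=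
    preservesColimitIso ((evaluation _ _).obj M) F
  rw [e.toLinearEquiv.subsingleton_congr, subsingleton_colimit_iff]
  have key (t : ℕ) := forall_exists_map_eq_zero_iff (powQuot a t) i M
    (fun s : {s : ℕ // t ≤ s} => powQuot a s) (fun s => powQuotMap a s.2)
  have hV : LocCohVanishes a M i ↔ ∀ (t : ℕ) (e : Abelian.Ext (powQuot a t) M i),
      ∃ s : {s : ℕ // t ≤ s}, (Abelian.Ext.mk₀ (powQuotMap a s.2)).comp e (zero_add i) = 0 := by
    simp only [LocCohVanishes, Subtype.exists]
    rfl
  simp only [hV, ← key]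
  constructor
  · intro h t e
    obtain ⟨k, f, hf⟩ := h (Opposite.op (Opposite.op t)) e
    exact ⟨⟨k.unop.unop, leOfHom f.unop.unop⟩, hf⟩
  · intro h t e
    obtain ⟨⟨s, hs⟩, h⟩ := h t.unop.unop e
    exact ⟨Opposite.op (Opposite.op s), (homOfLE hs).op.op, h⟩

section Exactness
variable {a : Ideal R} {A B C : Type u} [AddCommGroup A] [Module R A] [AddCommGroup B] [Module R B]
  [AddCommGroup C] [Module R C] {f : A →ₗ[R] B} {g : B →ₗ[R] C}

/-- The short complex attached to an exact pair of linear maps. -/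
abbrev exactComplex (h : Function.Exact f g) : ShortComplex (ModuleCat.{u} R) :=
  ShortComplex.mk (ModuleCat.ofHom f) (ModuleCat.ofHom g)
    (by ext x; exact h.apply_apply_eq_zero x)

theorem exactComplex_shortExact (hf : Function.Injective f) (hg : Function.Surjective g)
    (h : Function.Exact f g) : (exactComplex h).ShortExact where
  exact := (ShortComplex.ShortExact.moduleCat_exact_iff_function_exact _).2 h
  mono_f := (ModuleCat.mono_iff_injective _).2 hf
  epi_g := (ModuleCat.epi_iff_surjective _).2 hg

theorem LocCohVanishes.middle (hf : Function.Injective f) (hg : Function.Surjective g)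
    (h : Function.Exact f g) {i : ℕ} (hA : LocCohVanishes a A i) (hC : LocCohVanishes a C i) :
    LocCohVanishes a B i := by
  intro t e
  have hS := exactComplex_shortExact hf hg h
  obtain ⟨s, hs, h1⟩ := hC t (e.comp (Ext.mk₀ (ModuleCat.ofHom g)) (add_zero i))
  rw [res_comp] at h1
  obtain ⟨e1, he1⟩ := Ext.covariant_sequence_exact₂ _ hS _ h1
  obtain ⟨r, hr, h2⟩ := hA s e1
  refine ⟨r, hs.trans hr, ?_⟩
  rw [← res_res a hs hr, ← he1, res_comp, h2, Ext.zero_comp]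

theorem LocCohVanishes.right (hf : Function.Injective f) (hg : Function.Surjective g)
    (h : Function.Exact f g) {i : ℕ} (hB : LocCohVanishes a B i) (hA : LocCohVanishes a A (i + 1)) :
    LocCohVanishes a C i := by
  intro t e
  have hS := exactComplex_shortExact hf hg h
  obtain ⟨s, hs, h1⟩ := hA t (e.comp hS.extClass rfl)
  rw [res_comp] at h1
  obtain ⟨e1, he1⟩ := Ext.covariant_sequence_exact₃ _ hS _ rfl h1
  obtain ⟨r, hr, h2⟩ := hB s e1
  refine ⟨r, hs.trans hr, ?_⟩
  rw [← res_res a hs hr, ← he1, res_comp, h2, Ext.zero_comp]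

theorem LocCohVanishes.left (hf : Function.Injective f) (hg : Function.Surjective g)
    (h : Function.Exact f g) {i : ℕ} (hC : LocCohVanishes a C i) (hB : LocCohVanishes a B (i + 1)) :
    LocCohVanishes a A (i + 1) := by
  intro t e
  have hS := exactComplex_shortExact hf hg h
  obtain ⟨s, hs, h1⟩ := hB t (e.comp (Ext.mk₀ (ModuleCat.ofHom f)) (add_zero _))
  rw [res_comp] at h1
  obtain ⟨e1, he1⟩ := Ext.covariant_sequence_exact₁ _ hS _ h1 rfl
  obtain ⟨r, hr, h2⟩ := hC s e1
  refine ⟨r, hs.trans hr, ?_⟩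
  rw [← res_res a hs hr, ← he1, res_comp, h2, Ext.zero_comp]

theorem LocCohVanishes.of_linearEquiv {i : ℕ} (l : A ≃ₗ[R] B) (hA : LocCohVanishes a A i) :
    LocCohVanishes a B i := by
  intro t e
  obtain ⟨s, hs, h1⟩ := hA t (e.comp (Ext.mk₀ (ModuleCat.ofHom l.symm.toLinearMap)) (add_zero _))
  refine ⟨s, hs, ?_⟩
  rw [res_comp] at h1
  have := congrArg (fun y => y.comp (Ext.mk₀ (ModuleCat.ofHom l.toLinearMap)) (add_zero _)) h1
  rw [Ext.zero_comp] at this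
  rw [← this]
  simp [← ModuleCat.ofHom_comp]

theorem LocCohVanishes.of_subsingleton [Subsingleton A] (i : ℕ) : LocCohVanishes a A i := by
  intro t e
  refine ⟨t, le_rfl, ?_⟩
  have : 𝟙 (ModuleCat.of R A) = 0 := by ext x; exact Subsingleton.elim _ _
  rw [← Ext.comp_mk₀_id (res a le_rfl e), this]
  simp

theorem LocCohVanishes.of_moduleInjective (hA : Module.Injective R A) (i : ℕ) :
    LocCohVanishes a A (i + 1) := by
  intro t e
  have : Injective (ModuleCat.of R A) := (Module.injective_iff_injective_object R A).1 hA
  exact ⟨t, le_rfl, Ext.eq_zero_of_injective _⟩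

end Exactness

variable {a : Ideal R} {M N C : Type u} [AddCommGroup M] [Module R M]
  [AddCommGroup N] [Module R N] [AddCommGroup C] [Module R C]

theorem pow_smul_ext_eq_zero {x : R} (hx : x ∈ a) {X : ModuleCat.{u} R} {t i : ℕ}
    (e : Ext (powQuot a t) X i) : x ^ t • e = 0 := by
  have h : x ^ t • 𝟙 (powQuot a t) = 0 := by
    ext
    change x ^ t • (Ideal.Quotient.mk (a ^ t) 1 : R ⧸ a ^ t) = 0
    rw [← Ideal.Quotient.mkₐ_eq_mk R, ← map_smul, Ideal.Quotient.mkₐ_eq_mk,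
      Ideal.Quotient.eq_zero_iff_mem]
    simpa using Ideal.pow_mem_pow hx t
  rw [← Ext.mk₀_id_comp (x ^ t • e), Ext.comp_smul, ← Ext.smul_comp, ← Ext.mk₀_smul, h]
  simp

theorem LocCohVanishes.succ_of_regular {x : R} (hx : x ∈ a) {g : M →ₗ[R] N}
    (hM : IsSMulRegular M x) (hg : Function.Surjective g)
    (h : Function.Exact (LinearMap.lsmul R M x) g) {i : ℕ} (hN : LocCohVanishes a N i) :
    LocCohVanishes a M (i + 1) := by
  have hS := exactComplex_shortExact (f := LinearMap.lsmul R M x) hM hg h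
  suffices H : ∀ (n t : ℕ) (e : Ext (powQuot a t) (ModuleCat.of R M) (i + 1)), x ^ n • e = 0 →
      ∃ (s : ℕ) (h : t ≤ s), res a h e = 0 from
    fun t e => H t t e (pow_smul_ext_eq_zero hx e)
  intro n
  induction n with
  | zero => intro t e he; exact ⟨t, le_rfl, by simpa using congrArg (res a le_rfl) he⟩
  | succ n ih =>
    intro t e he
    obtain ⟨s, hs, h1⟩ := ih t (x • e) (by rw [smul_smul, ← pow_succ, he])
    have h2 : x • e = e.comp (Ext.mk₀ (ModuleCat.ofHom (LinearMap.lsmul R M x))) (add_zero _) := by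
      rw [Ext.smul_eq_comp_mk₀]
      rfl
    rw [h2, res_comp] at h1
    obtain ⟨e1, he1⟩ := Ext.covariant_sequence_exact₁ _ hS _ h1 rfl
    obtain ⟨r, hr, h3⟩ := hN s e1
    refine ⟨r, hs.trans hr, ?_⟩
    rw [← res_res a hs hr, ← he1, res_comp, h3, Ext.zero_comp]

theorem locCohVanishes_zero_of_regular {x : R} (hx : x ∈ a) (hM : IsSMulRegular M x) :
    LocCohVanishes a M 0 := by
  intro t e
  refine ⟨t, le_rfl, ?_⟩
  suffices e = 0 by simp [this]
  obtain ⟨φ, rfl⟩ := Ext.addEquiv₀.symm.surjective e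
  have h := pow_smul_ext_eq_zero hx (Ext.addEquiv₀.symm φ)
  change x ^ t • Ext.mk₀ φ = 0 at h
  rw [← Ext.mk₀_smul, Ext.mk₀_eq_zero_iff] at h
  change Ext.mk₀ φ = 0
  rw [Ext.mk₀_eq_zero_iff]
  ext
  exact hM.pow t (by simpa using congrArg (fun f => f.hom 1) h)

theorem locCohVanishes_zero_iff [IsNoetherianRing R] [Module.Finite R M] :
    LocCohVanishes a M 0 ↔ ∃ x ∈ a, IsSMulRegular M x := by
  refine ⟨fun h => ?_, fun ⟨x, hx, hM⟩ => locCohVanishes_zero_of_regular hx hM⟩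
  have h1 : Subsingleton ((R ⧸ a) →ₗ[R] M) := by
    refine subsingleton_of_forall_eq 0 fun φ => ?_
    let ψ : powQuot a 1 ⟶ ModuleCat.of R M :=
      ModuleCat.ofHom (φ ∘ₗ Submodule.mapQ _ _ LinearMap.id (by simp))
    obtain ⟨s, hs, h2⟩ := h 1 (Ext.mk₀ ψ)
    simp only [res, Ext.mk₀_comp_mk₀, Ext.mk₀_eq_zero_iff] at h2
    ext
    exact congrArg (fun f => f.hom (Ideal.Quotient.mk _ 1)) h2
  obtain ⟨r, hr, h2⟩ := IsSMulRegular.subsingleton_linearMap_iff.1 h1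
  exact ⟨r, by rwa [Ideal.annihilator_quotient] at hr, h2⟩

theorem forall_lt_succ_locCohVanishes_iff {x : R} (hx : x ∈ a) {g : M →ₗ[R] N}
    (hM : IsSMulRegular M x) (hg : Function.Surjective g)
    (h : Function.Exact (LinearMap.lsmul R M x) g) (n : ℕ) :
    (∀ j < n + 1, LocCohVanishes a M j) ↔ ∀ j < n, LocCohVanishes a N j := by
  constructor
  · intro H j hj
    exact .right (f := LinearMap.lsmul R M x) hM hg h (H j (by omega)) (H (j + 1) (by omega))
  · rintro H (_ | j) hj
    · exact locCohVanishes_zero_of_regular hx hM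
    · exact .succ_of_regular hx hM hg h (H j (by omega))

theorem isSMulRegular_linearMap_iff [IsNoetherianRing R] [Module.Finite R M] [Module.Finite R C]
    (hC : Module.annihilator R C = ⊥) {x : R} :
    IsSMulRegular (C →ₗ[R] M) x ↔ IsSMulRegular M x := by
  constructor
  · intro h
    have h1 : Subsingleton ((C ⧸ (Ideal.span {x} • ⊤ : Submodule R C)) →ₗ[R] M) := by
      refine subsingleton_of_forall_eq 0 fun φ => ?_
      have : φ ∘ₗ Submodule.mkQ _ = 0 := by
        refine h ?_
        ext c
        change x • φ (Submodule.Quotient.mk c) = x • 0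
        rw [smul_zero, ← map_smul, ← Submodule.Quotient.mk_smul,
          (Submodule.Quotient.mk_eq_zero _).2, map_zero]
        exact Submodule.smul_mem_smul (Ideal.mem_span_singleton_self x) trivial
      ext c
      exact LinearMap.congr_fun this c
    obtain ⟨r, hr, h2⟩ := IsSMulRegular.subsingleton_linearMap_iff.1 h1
    have h3 := Module.support_quotient (R := R) (M := C) (Ideal.span {x})
    rw [Module.support_eq_zeroLocus, Module.support_eq_zeroLocus (M := C), hC] at h3
    have h4 : r ∈ (Ideal.span {x}).radical := by
      refine (PrimeSpectrum.zeroLocus_subset_zeroLocus_iff _ _).1 ?_ hr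
      rw [h3]
      simp
    obtain ⟨k, hk⟩ := h4
    obtain ⟨y, hy⟩ := Ideal.mem_span_singleton'.1 hk
    exact .of_mul (hy ▸ h2.pow k)
  · intro h f g hfg
    ext c
    exact h (LinearMap.congr_fun hfg c)

theorem forall_lt_locCohVanishes_linearMap_iff [IsNoetherianRing R] [Module.Finite R C]
    (hC : Module.annihilator R C = ⊥) (n : ℕ) (M : Type u) [AddCommGroup M] [Module R M]
    [Module.Finite R M]
    (hM : ∀ i, 1 ≤ i → Subsingleton (Ext (ModuleCat.of R C) (ModuleCat.of R M) i)) :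
    (∀ j < n, LocCohVanishes a M j) ↔ ∀ j < n, LocCohVanishes a (C →ₗ[R] M) j := by
  induction n generalizing M with
  | zero => simp
  | succ n ih =>
    by_cases hx : ∃ x ∈ a, IsSMulRegular M x
    · obtain ⟨x, hxa, hx⟩ := hx
      have hx' := (isSMulRegular_linearMap_iff (R := R) (M := M) hC).2 hx
      have hex := LinearMap.exact_lsmul_mkQ_smul_top M x
      have hS := exactComplex_shortExact (f := LinearMap.lsmul R M x) hx
        (Submodule.mkQ_surjective _) hex
      rw [forall_lt_succ_locCohVanishes_iff hxa hx (Submodule.mkQ_surjective _) hex,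
        forall_lt_succ_locCohVanishes_iff hxa hx' (N := C →ₗ[R] QuotSMulTop x M)
          (g := LinearMap.compRight R (Submodule.mkQ _)) ?_ ?_]
      · refine ih _ fun i hi => subsingleton_of_forall_eq 0 fun e => ?_
        have := hM (i + 1) (by omega)
        obtain ⟨e', rfl⟩ := Ext.covariant_sequence_exact₃ _ hS e rfl (Subsingleton.elim _ _)
        have := hM i hi
        rw [Subsingleton.elim e' 0, Ext.zero_comp]
      · intro φ
        have := hM 1 le_rfl
        obtain ⟨e', he'⟩ := Ext.covariant_sequence_exact₃ _ hS (Ext.mk₀ (ModuleCat.ofHom φ))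
          rfl (Subsingleton.elim _ _)
        obtain ⟨ψ, rfl⟩ := Ext.addEquiv₀.symm.surjective e'
        change (Ext.mk₀ ψ).comp _ _ = _ at he'
        rw [Ext.mk₀_comp_mk₀] at he'
        have := congrArg ModuleCat.Hom.hom (Ext.mk₀_bijective _ _ |>.1 he')
        exact ⟨ψ.hom, this⟩
      · intro ψ
        constructor
        · intro h
          have h1 (c : C) : ψ c ∈ LinearMap.range (LinearMap.lsmul R M x) :=
            (hex _).1 (LinearMap.congr_fun h c)
          refine ⟨LinearMap.codRestrictOfInjective ψ (LinearMap.lsmul R M x) hx h1, ?_⟩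
          exact LinearMap.codRestrictOfInjective_comp ψ (LinearMap.lsmul R M x) hx h1
        · rintro ⟨φ, rfl⟩
          ext c
          exact hex.apply_apply_eq_zero (φ c)
    · refine iff_of_false (fun h => hx (locCohVanishes_zero_iff.1 (h 0 (by omega)))) fun h => hx ?_
      obtain ⟨x, hxa, h1⟩ := locCohVanishes_zero_iff.1 (h 0 (by omega))
      exact ⟨x, hxa, (isSMulRegular_linearMap_iff hC).1 h1⟩

variable (a M) in
/-- The submodule of elements killed by a power of `a`. -/
def powTorsion : Submodule R M where
  carrier := {x | ∃ n : ℕ, ∀ r ∈ a ^ n, r • x = 0}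
  zero_mem' := ⟨0, fun r _ => smul_zero r⟩
  add_mem' := by
    rintro x y ⟨n, hn⟩ ⟨m, hm⟩
    refine ⟨n + m, fun r hr => ?_⟩
    rw [smul_add, hn r (Ideal.pow_le_pow_right (by omega) hr),
      hm r (Ideal.pow_le_pow_right (by omega) hr), add_zero]
  smul_mem' := by
    rintro c x ⟨n, hn⟩
    exact ⟨n, fun r hr => by rw [smul_comm, hn r hr, smul_zero]⟩

theorem exists_pow_smul_eq_zero [Module.Finite R N] (φ : N →ₗ[R] M)
    (hφ : ∀ x, φ x ∈ powTorsion a M) : ∃ n : ℕ, ∀ r ∈ a ^ n, ∀ x, r • φ x = 0 := by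
  obtain ⟨S, hS⟩ := Module.Finite.fg_top (R := R) (M := N)
  choose n hn using hφ
  refine ⟨S.sup n, fun r hr x => ?_⟩
  have hx : x ∈ Submodule.span R (S : Set N) := hS ▸ trivial
  induction hx using Submodule.span_induction with
  | mem x hx => exact hn x r (Ideal.pow_le_pow_right (Finset.le_sup hx) hr)
  | zero => simp
  | add x y _ _ h1 h2 => rw [map_add, smul_add, h1, h2, add_zero]
  | smul c x _ h1 => rw [map_smul, smul_comm, h1, smul_zero]

theorem powTorsion_injective [IsNoetherianRing R] (hM : Module.Injective R M) :
    Module.Injective R (powTorsion a M) := by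
  refine Module.Baer.injective fun I g => ?_
  obtain ⟨t, ht⟩ := exists_pow_smul_eq_zero (a := a) ((powTorsion a M).subtype ∘ₗ g)
    fun x => (g x).2
  obtain ⟨k, hk⟩ := a.exists_pow_inf_eq_pow_smul I
  let q : I →ₗ[R] R ⧸ a ^ (t + k) := (a ^ (t + k)).mkQ ∘ₗ I.subtype
  have hq : LinearMap.ker q ≤ LinearMap.ker ((powTorsion a M).subtype ∘ₗ g) := by
    rintro ⟨x, hxI⟩ hx
    have h1 : x ∈ a ^ (t + k) := (Submodule.Quotient.mk_eq_zero _).1 hx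
    have h2 : x ∈ a ^ t • I := by
      have h3 : x ∈ a ^ (t + k) • (⊤ : Ideal R) ⊓ I := ⟨by simpa using h1, hxI⟩
      rw [hk (t + k) (by omega), Nat.add_sub_cancel] at h3
      exact Submodule.smul_mono le_rfl inf_le_right h3
    suffices ∀ y ∈ a ^ t • I, ∃ h : y ∈ I, ((powTorsion a M).subtype ∘ₗ g) ⟨y, h⟩ = 0 from
      (this x h2).2
    intro y hy
    induction hy using Submodule.smul_induction_on' with
    | smul r hr z hz =>
      refine ⟨I.smul_mem _ hz, ?_⟩
      rw [← ht r hr ⟨z, hz⟩, ← map_smul]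
      rfl
    | add x hx y hy h1 h2 =>
      obtain ⟨h1, h1'⟩ := h1
      obtain ⟨h2, h2'⟩ := h2
      refine ⟨I.add_mem h1 h2, ?_⟩
      rw [← zero_add (0 : M)]
      nth_rewrite 1 [← h1']
      rw [← h2', ← map_add]
      rfl
  obtain ⟨h, hh⟩ := hM.out ((LinearMap.ker q).liftQ q le_rfl)
    (LinearMap.ker_eq_bot.1 (Submodule.ker_liftQ_eq_bot _ _ _ le_rfl))
    ((LinearMap.ker q).liftQ _ hq)
  refine ⟨(h ∘ₗ (a ^ (t + k)).mkQ).codRestrict _ fun x => ⟨t + k, fun r hr => ?_⟩, fun x hx => ?_⟩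
  · rw [← map_smul, LinearMap.comp_apply]
    have : (a ^ (t + k)).mkQ (r • x) = 0 :=
      (Submodule.Quotient.mk_eq_zero _).2 (Ideal.mul_mem_right _ _ hr)
    rw [this, map_zero]
  · exact Subtype.ext (hh (Submodule.Quotient.mk ⟨x, hx⟩))

theorem exists_comp_eq_res (hM : powTorsion a M = ⊤) {g : M →ₗ[R] N} (hg : Function.Surjective g)
    {t : ℕ} (e : Ext (powQuot a t) (ModuleCat.of R N) 0) :
    ∃ (s : ℕ) (h : t ≤ s) (e' : Ext (powQuot a s) (ModuleCat.of R M) 0),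
      e'.comp (Ext.mk₀ (ModuleCat.ofHom g)) (add_zero 0) = res a h e := by
  obtain ⟨φ, rfl⟩ := Ext.addEquiv₀.symm.surjective e
  obtain ⟨y, hy⟩ := hg (φ.hom (Ideal.Quotient.mk _ 1))
  obtain ⟨n, hn⟩ : y ∈ powTorsion a M := hM ▸ trivial
  refine ⟨t + n, by omega, Ext.mk₀ (ModuleCat.ofHom ((a ^ (t + n)).liftQ
    (LinearMap.toSpanSingleton R M y) fun r hr => hn r (Ideal.pow_le_pow_right (by omega) hr))), ?_⟩
  change _ = (Ext.mk₀ _).comp (Ext.mk₀ φ) _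
  rw [Ext.mk₀_comp_mk₀, Ext.mk₀_comp_mk₀]
  congr 1
  ext
  change g ((1 : R) • y) = _
  rw [one_smul, hy]
  rfl

theorem exists_injective_embedding_of_powTorsion [IsNoetherianRing R] (hM : powTorsion a M = ⊤) :
    ∃ (G : Type u) (_ : AddCommGroup G) (_ : Module R G) (i : M →ₗ[R] G),
      Module.Injective R G ∧ powTorsion a G = ⊤ ∧ Function.Injective i := by
  obtain ⟨J, _, f, hf⟩ := EnoughInjectives.presentation (ModuleCat.of R M)
  have hJ : Module.Injective R J := (Module.injective_iff_injective_object R J).2 inferInstance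
  have hinj : Function.Injective f.hom := (ModuleCat.mono_iff_injective f).1 hf
  refine ⟨powTorsion a J, inferInstance, inferInstance, f.hom.codRestrict _ fun x => ?_,
    powTorsion_injective hJ,
    eq_top_iff.2 fun ⟨x, n, hn⟩ _ => ⟨n, fun r hr => Subtype.ext (hn r hr)⟩,
    fun x y h => hinj (congrArg Subtype.val h)⟩
  obtain ⟨n, hn⟩ : x ∈ powTorsion a M := hM ▸ trivial
  refine ⟨n, fun r hr => ?_⟩
  rw [← map_smul]
  exact (congrArg f.hom (hn r hr)).trans (map_zero _)

theorem powTorsion_eq_top_of_surjective (hM : powTorsion a M = ⊤) {g : M →ₗ[R] N}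
    (hg : Function.Surjective g) : powTorsion a N = ⊤ := by
  refine eq_top_iff.2 fun x _ => ?_
  obtain ⟨y, rfl⟩ := hg x
  obtain ⟨n, hn⟩ : y ∈ powTorsion a M := hM ▸ trivial
  exact ⟨n, fun r hr => by rw [← map_smul, hn r hr, map_zero]⟩

theorem locCohVanishes_succ_of_powTorsion [IsNoetherianRing R] (hM : powTorsion a M = ⊤) (j : ℕ) :
    LocCohVanishes a M (j + 1) := by
  induction j generalizing M with
  | zero =>
    obtain ⟨G, _, _, i, hG, hT, hi⟩ := exists_injective_embedding_of_powTorsion hM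
    intro t e
    have hsurj := Submodule.mkQ_surjective (LinearMap.range i)
    have hS := exactComplex_shortExact hi hsurj (LinearMap.exact_map_mkQ_range i)
    have : Injective (ModuleCat.of R G) := (Module.injective_iff_injective_object R _).1 hG
    obtain ⟨e0, rfl⟩ := Ext.covariant_sequence_exact₁ _ hS e (Ext.eq_zero_of_injective _) rfl
    obtain ⟨s, hs, e', he'⟩ := exists_comp_eq_res hT hsurj e0
    refine ⟨s, hs, ?_⟩
    rw [res_comp, ← he']
    refine (Ext.comp_assoc_of_second_deg_zero ..).trans ?_
    rw [show Ext.comp (Ext.mk₀ (ModuleCat.ofHom (LinearMap.range i).mkQ)) hS.extClass _ = 0 from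
      hS.comp_extClass, Ext.comp_zero]
  | succ j ih =>
    obtain ⟨G, _, _, i, hG, hT, hi⟩ := exists_injective_embedding_of_powTorsion hM
    have hsurj := Submodule.mkQ_surjective (LinearMap.range i)
    exact .left hi hsurj (LinearMap.exact_map_mkQ_range i)
      (ih (powTorsion_eq_top_of_surjective hT hsurj)) (.of_moduleInjective hG _)

theorem locCohVanishes_of_forall_prime [IsNoetherianRing R] {I : Ideal R} {j : ℕ}
    (hI : ∀ p : PrimeSpectrum R, I ≤ p.asIdeal → LocCohVanishes a (R ⧸ p.asIdeal) j)
    [hN : Module.Finite R N] (hIN : I ≤ Module.annihilator R N) : LocCohVanishes a N j := by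
  induction hN using IsNoetherianRing.induction_on_isQuotientEquivQuotientPrime R with
  | subsingleton N => exact .of_subsingleton j
  | quotient N p e =>
    rw [e.annihilator_eq, Ideal.annihilator_quotient] at hIN
    exact .of_linearEquiv e.symm (hI p hIN)
  | exact N₁ N₂ N₃ f g hf hg hfg h₁ h₃ =>
    exact .middle hf hg hfg (h₁ (hIN.trans (f.annihilator_le_of_injective hf)))
      (h₃ (hIN.trans (g.annihilator_le_of_surjective hg)))

theorem locCohVanishes_quotient_prime [IsNoetherianRing R] (j : ℕ) (p : PrimeSpectrum R)
    (hp : Order.coheight p < j) : LocCohVanishes a (R ⧸ p.asIdeal) j := by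
  induction j generalizing p with
  | zero => simp at hp
  | succ j ih =>
    by_cases hap : a ≤ p.asIdeal
    · refine locCohVanishes_succ_of_powTorsion (eq_top_iff.2 fun x _ => ⟨1, fun r hr => ?_⟩) j
      have : r ∈ Module.annihilator R (R ⧸ p.asIdeal) := by
        rw [Ideal.annihilator_quotient]
        exact hap (by simpa using hr)
      exact Module.mem_annihilator.1 this x
    · obtain ⟨x, hxa, hxp⟩ := SetLike.not_le_iff_exists.1 hap
      have hx : IsSMulRegular (R ⧸ p.asIdeal) x := by
        refine isSMulRegular_iff_right_eq_zero_of_smul.2 fun y hy => ?_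
        obtain ⟨y, rfl⟩ := Ideal.Quotient.mk_surjective y
        have h1 : x * y ∈ p.asIdeal := Ideal.Quotient.eq_zero_iff_mem.1 hy
        exact Ideal.Quotient.eq_zero_iff_mem.2 ((p.isPrime.mem_or_mem h1).resolve_left hxp)
      refine .succ_of_regular hxa hx (Submodule.mkQ_surjective _)
        (LinearMap.exact_lsmul_mkQ_smul_top _ x) ?_
      refine locCohVanishes_of_forall_prime (I := p.asIdeal ⊔ Ideal.span {x}) (fun q hq => ih q ?_) ?_
      · have hlt : p < q := by
          refine lt_of_le_of_ne (le_sup_left.trans hq) ?_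
          rintro rfl
          exact hxp (hq (Ideal.mem_sup_right (Ideal.mem_span_singleton_self x)))
        have h1 := Order.coheight_add_one_le hlt
        have h2 := h1.trans_lt hp
        push_cast at h2
        exact lt_of_add_lt_add_right h2
      · refine sup_le ?_ ((Ideal.span_singleton_le_iff_mem _).2 ?_)
        · refine le_trans ?_ (LinearMap.annihilator_le_of_surjective (Submodule.mkQ _)
            (Submodule.mkQ_surjective _))
          rw [Ideal.annihilator_quotient]
        · refine Module.mem_annihilator.2 fun y => ?_
          obtain ⟨y, rfl⟩ := Submodule.mkQ_surjective _ y
          rw [← map_smul]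
          exact (Submodule.Quotient.mk_eq_zero _).2 (Submodule.smul_mem_pointwise_smul _ _ _ trivial)

theorem exists_forall_locCohVanishes [IsNoetherianRing R] [IsLocalRing R] (a : Ideal R) :
    ∃ d : ℕ, ∀ (N : Type u) [AddCommGroup N] [Module R N] [Module.Finite R N], ∀ j ≥ d,
      LocCohVanishes a N j := by
  obtain ⟨d, hd⟩ : ∃ d : ℕ, ringKrullDim R ≤ d := by
    obtain ⟨d, hd⟩ := WithBot.ne_bot_iff_exists.1 (ringKrullDim_ne_bot (R := R))
    have h : (d : WithBot ℕ∞) < ⊤ := hd ▸ ringKrullDim_lt_top (R := R)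
    obtain ⟨n, rfl⟩ := ENat.ne_top_iff_exists.1 (WithBot.coe_lt_coe.1 h).ne
    exact ⟨n, hd.ge⟩
  refine ⟨d + 1, fun N _ _ _ j hj =>
    locCohVanishes_of_forall_prime (I := ⊥) (fun p _ => locCohVanishes_quotient_prime j p ?_) bot_le⟩
  have h1 := (Order.coheight_le_krullDim p).trans hd
  have h2 : Order.coheight p ≤ d := by exact_mod_cast h1
  exact h2.trans_lt (by exact_mod_cast hj)

theorem LocCohVanishes.quotient_prime_of_faithful [IsNoetherianRing R] [Module.Finite R C]
    (hC : Module.annihilator R C = ⊥) {j : ℕ} (hCj : LocCohVanishes a C j)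
    (hj : ∀ (N : Type u) [AddCommGroup N] [Module R N] [Module.Finite R N],
      LocCohVanishes a N (j + 1)) (I : Ideal R) (hI : I.IsPrime) : LocCohVanishes a (R ⧸ I) j := by
  induction I using WellFoundedGT.induction with
  | ind I ih =>
  obtain ⟨f, hf⟩ : ∃ f : C →ₗ[R] R ⧸ I, f ≠ 0 := by
    by_contra! h
    obtain ⟨r, hr, hr'⟩ :=
      IsSMulRegular.subsingleton_linearMap_iff.1 (subsingleton_of_forall_eq 0 h)
    rw [hC, Ideal.mem_bot] at hr
    subst hr
    exact not_subsingleton (R ⧸ I) (IsSMulRegular.zero_iff_subsingleton.1 hr')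
  obtain ⟨c, hc⟩ : ∃ c, f c ≠ 0 := by
    by_contra! h
    exact hf (LinearMap.ext h)
  obtain ⟨y, hy⟩ := Ideal.Quotient.mk_surjective (f c)
  have hyI : y ∉ I := fun h => hc (hy ▸ Ideal.Quotient.eq_zero_iff_mem.2 h)
  have hrange : LocCohVanishes a (LinearMap.range f) j := by
    refine .right (f := (LinearMap.ker f).subtype) (Submodule.injective_subtype _)
      f.surjective_rangeRestrict ?_ hCj (hj _)
    rw [LinearMap.exact_iff]
    simp
  refine .middle (f := (LinearMap.range f).subtype) (Submodule.injective_subtype _)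
    (Submodule.mkQ_surjective _) (LinearMap.exact_subtype_mkQ _) hrange ?_
  refine locCohVanishes_of_forall_prime (I := I ⊔ Ideal.span {y})
    (fun q hq => ih q.asIdeal ?_ q.isPrime) ?_
  · refine lt_of_le_of_ne (le_sup_left.trans hq) ?_
    rintro rfl
    exact hyI (hq (Ideal.mem_sup_right (Ideal.mem_span_singleton_self y)))
  · refine sup_le ?_ ((Ideal.span_singleton_le_iff_mem _).2 ?_)
    · refine le_trans ?_ (LinearMap.annihilator_le_of_surjective (Submodule.mkQ _)
        (Submodule.mkQ_surjective _))
      rw [Ideal.annihilator_quotient]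
    · refine Module.mem_annihilator.2 fun z => ?_
      obtain ⟨z, rfl⟩ := Submodule.mkQ_surjective _ z
      obtain ⟨z, rfl⟩ := Ideal.Quotient.mk_surjective z
      rw [← map_smul]
      refine (Submodule.Quotient.mk_eq_zero _).2 ⟨z • c, ?_⟩
      rw [map_smul, ← hy]
      change Ideal.Quotient.mk I (z * y) = Ideal.Quotient.mk I (y * z)
      rw [mul_comm]

theorem locCohVanishes_of_faithful [IsNoetherianRing R] [IsLocalRing R] [Module.Finite R C]
    (hC : Module.annihilator R C = ⊥) {n : ℕ} (hCn : ∀ j ≥ n, LocCohVanishes a C j)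
    [Module.Finite R N] : ∀ j ≥ n, LocCohVanishes a N j := by
  obtain ⟨d, hd⟩ := exists_forall_locCohVanishes a
  suffices H : ∀ k : ℕ, ∀ j ≥ n, d ≤ j + k → ∀ (N : Type u) [AddCommGroup N] [Module R N]
      [Module.Finite R N], LocCohVanishes a N j from
    fun j hj => H d j hj (by omega) N
  intro k
  induction k with
  | zero => intro j _ hjd N _ _ _; exact hd N j hjd
  | succ k ih =>
    intro j hj hjd N _ _ _
    exact locCohVanishes_of_forall_prime (I := ⊥)
      (fun p _ => (hCn j hj).quotient_prime_of_faithful hC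
        (ih (j + 1) (by omega) (by omega)) p.asIdeal p.isPrime) bot_le

theorem sInf_eq_of_forall_lt_iff {S T : Set ℕ}
    (h : ∀ n, (∀ j < n, j ∉ S) ↔ ∀ j < n, j ∉ T) : sInf S = sInf T := by
  have key {S T : Set ℕ} (h : ∀ n, (∀ j < n, j ∉ S) → ∀ j < n, j ∉ T) : ∀ m ∈ T, sInf S ≤ m := by
    intro m hm
    by_contra! hlt
    exact h (m + 1) (fun j hj => Nat.notMem_of_lt_sInf (by omega)) m (by omega) hm
  rcases T.eq_empty_or_nonempty with rfl | hT
  · have hS : S = ∅ := Set.eq_empty_iff_forall_notMem.2 fun m =>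
      (h (m + 1)).2 (by simp) m (by omega)
    rw [hS]
  · have hT' := Nat.sInf_mem hT
    have hS : S.Nonempty := by
      by_contra! hS
      exact (h (sInf T + 1)).1 (by simp [hS]) _ (by omega) hT'
    exact le_antisymm (key (fun n => (h n).1) _ hT')
      (key (fun n => (h n).2) _ (Nat.sInf_mem hS))

theorem sSup_eq_of_forall_ge_iff {S T : Set ℕ}
    (h : ∀ n, (∀ j ≥ n, j ∉ S) ↔ ∀ j ≥ n, j ∉ T) : sSup S = sSup T := by
  have key {S : Set ℕ} (n : ℕ) : n ∈ upperBounds S ↔ ∀ j ≥ n + 1, j ∉ S :=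
    ⟨fun hn j hj hjS => by have := hn hjS; omega, fun hn j hjS => by
      by_contra! hlt
      exact hn j hlt hjS⟩
  have hub : upperBounds S = upperBounds T := by
    ext n
    rw [key, key, h]
  by_cases hS : BddAbove S
  · have hT : BddAbove T := by rwa [BddAbove, ← hub]
    refine le_antisymm (csSup_le' ?_) (csSup_le' ?_)
    · rw [hub]
      exact fun _ => le_csSup hT
    · rw [← hub]
      exact fun _ => le_csSup hS
  · have hT : ¬ BddAbove T := by rwa [BddAbove, ← hub]
    rw [csSup_of_not_bddAbove hS, csSup_of_not_bddAbove hT]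

end LocCohExt
end

noncomputable section
open CategoryTheory TensorProduct

/-- A semidualizing module has full support, the same cohomological
dimension and the same grade as `R` with respect to any ideal `a`; consequently it is
relative Cohen-Macaulay with respect to `a` whenever `R` is. -/
theorem stmt_3 (R : Type u) [CommRing R] [IsNoetherianRing R] [IsLocalRing R]
    (C : ModuleCat.{u} R) (hC : IsSemidualizing R C) (a : Ideal R) :
    Module.support R ↥C = Set.univ ∧
    lcCohomDim R a C = lcCohomDim R a (ModuleCat.of R R) ∧
    lcGrade R a C = lcGrade R a (ModuleCat.of R R) ∧
    (IsRelativeCM R a (ModuleCat.of R R) → IsRelativeCM R a C) := by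
  obtain ⟨hfin, hbij, hext⟩ := hC
  have hann : Module.annihilator R C = ⊥ := eq_bot_iff.2 fun r hr => hbij.1 <| by
    ext c
    exact (Module.mem_annihilator.1 hr c).trans (zero_smul R c).symm
  have hannR : Module.annihilator R R = ⊥ := eq_bot_iff.2 fun r hr => by
    simpa using Module.mem_annihilator.1 hr 1
  have hset (M : ModuleCat.{u} R) (j : ℕ) :
      j ∉ {i : ℕ | Nontrivial ((localCohomology a i).obj M)} ↔ LocCohExt.LocCohVanishes a M j := by
    rw [← LocCohExt.subsingleton_localCohomology_iff, Set.mem_ofPred_eq, not_nontrivial_iff_subsingleton]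
  let e : R ≃ₗ[R] (C →ₗ[R] C) := LinearEquiv.ofBijective (LinearMap.lsmul R C) hbij
  have hlt (n : ℕ) : (∀ j < n, LocCohExt.LocCohVanishes a C j) ↔ ∀ j < n, LocCohExt.LocCohVanishes a R j := by
    rw [LocCohExt.forall_lt_locCohVanishes_linearMap_iff hann n C
      fun i hi => (LocCohExt.subsingleton_iff C C i).1 (hext i hi)]
    exact forall₂_congr fun j _ => ⟨.of_linearEquiv e.symm, .of_linearEquiv e⟩
  have hge (n : ℕ) : (∀ j ≥ n, LocCohExt.LocCohVanishes a C j) ↔ ∀ j ≥ n, LocCohExt.LocCohVanishes a R j :=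
    ⟨fun h => LocCohExt.locCohVanishes_of_faithful hann h, fun h => LocCohExt.locCohVanishes_of_faithful hannR h⟩
  refine ⟨?_, LocCohExt.sSup_eq_of_forall_ge_iff fun n => ?_, LocCohExt.sInf_eq_of_forall_lt_iff fun n => ?_, ?_⟩
  · rw [Module.support_eq_zeroLocus, hann]
    simp
  · simpa only [hset] using hge n
  · simpa only [hset] using hlt n
  · rintro ⟨n, hn, huniq⟩
    have hRv (j : ℕ) (hj : j ≠ n) : LocCohExt.LocCohVanishes a R j :=
      (hset (ModuleCat.of R R) j).1 fun h => hj (huniq j h)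
    have hlow : ∀ j < n, LocCohExt.LocCohVanishes a C j := (hlt n).2 fun j hj => hRv j hj.ne
    have hhigh : ∀ j ≥ n + 1, LocCohExt.LocCohVanishes a C j := (hge (n + 1)).2 fun j hj => hRv j (by omega)
    refine ⟨n, ?_, fun m hm => ?_⟩
    · by_contra hCn
      have hCn := (hset C n).1 hCn
      exact (hset (ModuleCat.of R R) n).2 ((hlt (n + 1)).1 (fun j hj => by
        rcases Nat.lt_succ_iff_lt_or_eq.1 hj with h | rfl
        exacts [hlow j h, hCn]) n (by omega)) hn
    · by_contra hmn
      rcases Nat.lt_or_gt_of_ne hmn with h | h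
      · exact (hset C m).2 (hlow m h) hm
      · exact (hset C m).2 (hhigh m h) hm

end
end

section
/- Let (R,m) be a Noetherian local ring, let a be an ideal of R such that R is relative Cohen-Macaulay with respect to a with cd(a,R) = n, and let M be a finitely generated R-module. Then there is an isomorphism H_a^n(R) ⊗_R M ≅ H_a^n(M); in particular, the functor H_a^n(-) is right exact. -/
noncomputable section

open CategoryTheory TensorProduct Limits Opposite

universe u

namespace CategoryTheory.ProjectiveResolution

variable {R : Type u} [CommRing R] {X X' : ModuleCat.{u} R}

/-- The module of degree `i` cocycles. -/
def homCocycles (P : ProjectiveResolution X) (i : ℕ) (Y : ModuleCat.{u} R) :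
    Submodule R (P.complex.X i ⟶ Y) :=
  LinearMap.ker (Linear.leftComp R Y (P.complex.d (i + 1) i))

lemma mem_homCocycles {P : ProjectiveResolution X} {i : ℕ} {Y : ModuleCat.{u} R}
    {f : P.complex.X i ⟶ Y} : f ∈ P.homCocycles i Y ↔ P.complex.d (i + 1) i ≫ f = 0 :=
  Iff.rfl

/-- The chain complex in `(ModuleCat R)ᵒᵖ` with terms `Hom(P_i, Y)`. -/
abbrev homComplex (P : ProjectiveResolution X) (Y : ModuleCat.{u} R) :
    ChainComplex (ModuleCat.{u} R)ᵒᵖ ℕ :=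
  ((((linearYoneda R (ModuleCat.{u} R)).obj Y).rightOp).mapHomologicalComplex _).obj P.complex

/-- `Ext` as the homology of `homComplex`. -/
def extIso (P : ProjectiveResolution X) (i : ℕ) (Y : ModuleCat.{u} R) :
    op (((Ext R (ModuleCat.{u} R) i).obj (op X)).obj Y) ≅ (P.homComplex Y).homology i :=
  P.isoLeftDerivedObj ((linearYoneda R (ModuleCat.{u} R)).obj Y).rightOp i

lemma extIso_naturality_right (P : ProjectiveResolution X) (i : ℕ) {Y Y' : ModuleCat.{u} R}
    (g : Y ⟶ Y') :
    (((Ext R (ModuleCat.{u} R) i).obj (op X)).map g).op ≫ (P.extIso i Y).hom =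
      (P.extIso i Y').hom ≫ HomologicalComplex.homologyMap
        ((NatTrans.mapHomologicalComplex
          (NatTrans.rightOp ((linearYoneda R (ModuleCat.{u} R)).map g)) _).app P.complex) i := by
  rw [← Iso.eq_comp_inv, Category.assoc]
  exact P.leftDerived_app_eq (NatTrans.rightOp ((linearYoneda R (ModuleCat.{u} R)).map g)) i

lemma extIso_naturality_left (P : ProjectiveResolution X) (Q : ProjectiveResolution X')
    (φ : Q.complex ⟶ P.complex) (h : X' ⟶ X) (comm : φ.f 0 ≫ P.π.f 0 = Q.π.f 0 ≫ h)
    (i : ℕ) (Y : ModuleCat.{u} R) :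
    (((Ext R (ModuleCat.{u} R) i).map h.op).app Y).op ≫ (P.extIso i Y).hom =
      (Q.extIso i Y).hom ≫ HomologicalComplex.homologyMap
        ((((linearYoneda R (ModuleCat.{u} R)).obj Y).rightOp.mapHomologicalComplex _).map φ) i :=
  isoLeftDerivedObj_hom_naturality h Q P φ comm _ i

/-- Evaluation of `Hom(P_i, Y)`-opcycles as homomorphisms. -/
def homOpcycles (P : ProjectiveResolution X) (i : ℕ) (Y : ModuleCat.{u} R) :
    ((P.homComplex Y).opcycles i).unop →ₗ[R] (P.complex.X i ⟶ Y) :=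
  ((P.homComplex Y).pOpcycles i).unop.hom

/-- The class in `Ext` of an opcycle of `homComplex`. -/
def homExt (P : ProjectiveResolution X) (i : ℕ) (Y : ModuleCat.{u} R) :
    ((P.homComplex Y).opcycles i).unop →ₗ[R] ((Ext R (ModuleCat.{u} R) i).obj (op X)).obj Y :=
  ((P.extIso i Y).hom ≫ (P.homComplex Y).homologyι i).unop.hom

lemma homOpcycles_injective (P : ProjectiveResolution X) (i : ℕ) (Y : ModuleCat.{u} R) :
    Function.Injective (P.homOpcycles i Y) :=
  (ModuleCat.mono_iff_injective _).1
    (inferInstance : Mono ((P.homComplex Y).pOpcycles i).unop)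

lemma homExt_surjective (P : ProjectiveResolution X) (i : ℕ) (Y : ModuleCat.{u} R) :
    Function.Surjective (P.homExt i Y) :=
  (ModuleCat.epi_iff_surjective _).1
    (inferInstance : Epi ((P.extIso i Y).hom ≫ (P.homComplex Y).homologyι i).unop)

lemma range_homOpcycles (P : ProjectiveResolution X) (i : ℕ) (Y : ModuleCat.{u} R) :
    LinearMap.range (P.homOpcycles i Y) = P.homCocycles i Y := by
  have h : (ShortComplex.mk _ _ ((P.homComplex Y).d_pOpcycles (i + 1) i)).Exact :=
    ShortComplex.exact_of_g_is_cokernel _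
      ((P.homComplex Y).opcyclesIsCokernel (i + 1) i (by simp))
  exact ((ShortComplex.moduleCat_exact_iff_range_eq_ker _).1 h.unop)

lemma ker_homExt (P : ProjectiveResolution X) (i : ℕ) (Y : ModuleCat.{u} R)
    (w) (hw : P.homExt i Y w = 0) :
    ∃ (j : ℕ) (g : P.complex.X j ⟶ Y), P.homOpcycles i Y w = P.complex.d i j ≫ g := by
  let j := (ComplexShape.down ℕ).next i
  have h : (ShortComplex.mk _ _ ((P.homComplex Y).homologyι_comp_fromOpcycles i j)).Exact :=
    ShortComplex.exact_of_f_is_kernel _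
      ((P.homComplex Y).homologyIsKernel i j rfl)
  have h' := (ShortComplex.moduleCat_exact_iff _).1 h.unop w
  have hw' : ((P.homComplex Y).homologyι i).unop.hom w = 0 := by
    apply (ModuleCat.mono_iff_injective (P.extIso i Y).hom.unop).1 inferInstance
    exact hw.trans (map_zero _).symm
  obtain ⟨g, hg⟩ := h' hw'
  refine ⟨j, g, ?_⟩
  have := congr_arg (fun k => k.unop.hom g) ((P.homComplex Y).p_fromOpcycles i j)
  subst hg
  exact this

lemma homExt_eq_zero (P : ProjectiveResolution X) (i j : ℕ) (Y : ModuleCat.{u} R)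
    (w) (g : P.complex.X j ⟶ Y) (hw : P.homOpcycles i Y w = P.complex.d i j ≫ g) :
     P.homExt i Y w = 0 := by
  have : w = ((P.homComplex Y).fromOpcycles i j).unop.hom g := by
    apply homOpcycles_injective
    rw [hw]
    exact (congr_arg (fun k => k.unop.hom g) ((P.homComplex Y).p_fromOpcycles i j)).symm
  subst this
  have := congr_arg (fun k => k.unop.hom g) ((P.homComplex Y).homologyι_comp_fromOpcycles i j)
  exact (congr_arg (P.extIso i Y).hom.unop.hom this).trans (map_zero _)

/-- The class in `Ext` of a cocycle. -/
def extClass (P : ProjectiveResolution X) (i : ℕ) (Y : ModuleCat.{u} R) :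
    P.homCocycles i Y →ₗ[R] ((Ext R (ModuleCat.{u} R) i).obj (op X)).obj Y :=
  P.homExt i Y ∘ₗ
    (LinearEquiv.ofInjective _ (P.homOpcycles_injective i Y)).symm.toLinearMap ∘ₗ
    (LinearEquiv.ofEq _ _ (P.range_homOpcycles i Y)).symm.toLinearMap

lemma extClass_eq (P : ProjectiveResolution X) (i : ℕ) (Y : ModuleCat.{u} R)
   (w) (f : P.homCocycles i Y) (h : P.homOpcycles i Y w = f) :
   P.extClass i Y f = P.homExt i Y w := by
  have : (LinearEquiv.ofEq _ _ (P.range_homOpcycles i Y)).symm f =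
    LinearEquiv.ofInjective _ (P.homOpcycles_injective i Y) w := by
    ext1
    exact h.symm
  rw [extClass, LinearMap.comp_apply, LinearMap.comp_apply, LinearEquiv.coe_coe,
    LinearEquiv.coe_coe, this, LinearEquiv.symm_apply_apply]

lemma exists_homOpcycles (P : ProjectiveResolution X) {i : ℕ} {Y : ModuleCat.{u} R}
    (f : P.homCocycles i Y) : ∃ w, P.homOpcycles i Y w = f := by
  exact (P.range_homOpcycles i Y).ge f.2

lemma extClass_surjective (P : ProjectiveResolution X) (i : ℕ) (Y : ModuleCat.{u} R) :
    Function.Surjective (P.extClass i Y) := fun z => by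
  obtain ⟨w, rfl⟩ := P.homExt_surjective i Y z
  have : P.homOpcycles i Y w ∈ P.homCocycles i Y := by
    rw [← range_homOpcycles]; exact ⟨w, rfl⟩
  exact ⟨⟨_, this⟩, P.extClass_eq i Y w _ rfl⟩

lemma extClass_eq_zero_iff (P : ProjectiveResolution X) {i : ℕ} {Y : ModuleCat.{u} R}
    (f : P.homCocycles i Y) : P.extClass i Y f = 0 ↔
      ∃ (j : ℕ) (g : P.complex.X j ⟶ Y), f.1 = P.complex.d i j ≫ g := by
  obtain ⟨w, hw⟩ := P.exists_homOpcycles f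
  rw [P.extClass_eq i Y w f hw, ← hw]
  exact ⟨P.ker_homExt i Y w, fun ⟨j, g, h⟩ => P.homExt_eq_zero i j Y w g h⟩

lemma comp_mem_homCocycles {P : ProjectiveResolution X} {i : ℕ} {Y Y' : ModuleCat.{u} R}
    {f : P.complex.X i ⟶ Y} (hf : f ∈ P.homCocycles i Y) (g : Y ⟶ Y') :
    f ≫ g ∈ P.homCocycles i Y' := by
  rw [mem_homCocycles] at *; rw [← Category.assoc, hf, zero_comp]

lemma chainMap_comp_mem_homCocycles {P : ProjectiveResolution X} {Q : ProjectiveResolution X'}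
    (φ : Q.complex ⟶ P.complex) {i : ℕ} {Y : ModuleCat.{u} R}
    {f : P.complex.X i ⟶ Y} (hf : f ∈ P.homCocycles i Y) :
    φ.f i ≫ f ∈ Q.homCocycles i Y := by
  rw [mem_homCocycles] at *; rw [← φ.comm_assoc, hf, comp_zero]

lemma extClass_map (P : ProjectiveResolution X) {i : ℕ} {Y Y' : ModuleCat.{u} R}
    (f : P.homCocycles i Y) (g : Y ⟶ Y') :
    ((Ext R (ModuleCat.{u} R) i).obj (op X)).map g (P.extClass i Y f) =
      P.extClass i Y' ⟨f.1 ≫ g, comp_mem_homCocycles f.2 g⟩ := by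
  obtain ⟨w, hw⟩ := P.exists_homOpcycles f
  let β := (NatTrans.mapHomologicalComplex (NatTrans.rightOp
    ((linearYoneda R (ModuleCat.{u} R)).map g)) (ComplexShape.down ℕ)).app P.complex
  have h2 := HomologicalComplex.p_opcyclesMap β i
  rw [P.extClass_eq i Y w f hw, P.extClass_eq i Y' ((HomologicalComplex.opcyclesMap β i).unop.hom w)]
  · have h4 : (((Ext R (ModuleCat.{u} R) i).obj (op X)).map g).op ≫ (P.extIso i Y).hom ≫
        (P.homComplex Y).homologyι i = (P.extIso i Y').hom ≫
        (P.homComplex Y').homologyι i ≫ HomologicalComplex.opcyclesMap β i := by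
      rw [← HomologicalComplex.homologyι_naturality β i, ← Category.assoc,
        extIso_naturality_right, Category.assoc]
    exact congr_arg (fun k => k.unop.hom w) h4
  · refine (congr_arg (fun k => k.unop.hom w) h2).trans ?_
    have : (P.homOpcycles i Y w) ≫ g = f.1 ≫ g := by rw [hw]
    exact this

lemma extClass_chainMap (P : ProjectiveResolution X) (Q : ProjectiveResolution X')
    (φ : Q.complex ⟶ P.complex) (h : X' ⟶ X) (comm : φ.f 0 ≫ P.π.f 0 = Q.π.f 0 ≫ h)
    {i : ℕ} {Y : ModuleCat.{u} R} (f : P.homCocycles i Y) :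
    ((Ext R (ModuleCat.{u} R) i).map h.op).app Y (P.extClass i Y f) =
      Q.extClass i Y ⟨φ.f i ≫ f.1, chainMap_comp_mem_homCocycles φ f.2⟩ := by
  obtain ⟨w, hw⟩ := P.exists_homOpcycles f
  let β := (((linearYoneda R (ModuleCat.{u} R)).obj Y).rightOp.mapHomologicalComplex
    (ComplexShape.down ℕ)).map φ
  have h2 := HomologicalComplex.p_opcyclesMap β i
  rw [P.extClass_eq i Y w f hw, Q.extClass_eq i Y ((HomologicalComplex.opcyclesMap β i).unop.hom w)]
  · have h4 : (((Ext R (ModuleCat.{u} R) i).map h.op).app Y).op ≫ (P.extIso i Y).hom ≫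
        (P.homComplex Y).homologyι i = (Q.extIso i Y).hom ≫
        (Q.homComplex Y).homologyι i ≫ HomologicalComplex.opcyclesMap β i := by
      rw [← HomologicalComplex.homologyι_naturality β i, ← Category.assoc,
        extIso_naturality_left P Q φ h comm, Category.assoc]
    exact congr_arg (fun k => k.unop.hom w) h4
  · refine (congr_arg (fun k => k.unop.hom w) h2).trans ?_
    have : φ.f i ≫ (P.homOpcycles i Y w) = φ.f i ≫ f.1 := by rw [hw]
    exact this

end CategoryTheory.ProjectiveResolution

namespace localCohomology

variable {R : Type u} [CommRing R] (a : Ideal R)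

/-- The module `R ⧸ a ^ t`, as it occurs in the definition of local cohomology. -/
abbrev quotPow (t : ℕ) : ModuleCat.{u} R := (ringModIdeals (idealPowersDiagram a)).obj (op t)

/-- The projection `R ⧸ a ^ s ⟶ R ⧸ a ^ t` for `t ≤ s`. -/
abbrev quotPowMap {t s : ℕ} (h : t ≤ s) : quotPow a s ⟶ quotPow a t :=
  (ringModIdeals (idealPowersDiagram a)).map (homOfLE h).op

/-- Local cohomology of `M` as a colimit of modules. -/
def isColimitObj (i : ℕ) (M : ModuleCat.{u} R) :
    IsColimit (((evaluation _ _).obj M).mapCocone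
      (colimit.cocone (diagram (idealPowersDiagram a) i))) :=
  isColimitOfPreserves ((evaluation _ _).obj M) (colimit.isColimit _)

/-- The natural map from `Ext` to local cohomology. -/
def ofExt (t i : ℕ) : (Ext R (ModuleCat.{u} R) i).obj (op (quotPow a t)) ⟶ localCohomology a i :=
  colimit.ι (diagram (idealPowersDiagram a) i) (op (op t))

instance : PreservesFilteredColimitsOfSize.{0, 0} (forget (ModuleCat.{u} R)) :=
  preservesFilteredColimitsOfSize_shrink.{0, u, 0, u} _

section Cocycles

variable {a}
variable (P : ∀ t, ProjectiveResolution (quotPow a t))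

/-- The class in local cohomology of a cocycle. -/
def cls (t i : ℕ) (M : ModuleCat.{u} R) :
    (P t).homCocycles i M →ₗ[R] (localCohomology a i).obj M :=
  ((ofExt a t i).app M).hom ∘ₗ (P t).extClass i M

lemma exists_cls {i : ℕ} {M : ModuleCat.{u} R} (z : (localCohomology a i).obj M) :
    ∃ t f, cls P t i M f = z := by
  obtain ⟨t, y, rfl⟩ := Concrete.isColimit_exists_rep _ (isColimitObj a i M) z
  obtain ⟨f, rfl⟩ := (P t.unop.unop).extClass_surjective i M y
  exact ⟨_, f, rfl⟩

lemma cls_map {t i : ℕ} {M N : ModuleCat.{u} R} (f : (P t).homCocycles i M) (g : M ⟶ N) :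
    (localCohomology a i).map g (cls P t i M f) =
      cls P t i N ⟨f.1 ≫ g, ProjectiveResolution.comp_mem_homCocycles f.2 g⟩ := by
  have h := ConcreteCategory.congr_hom ((ofExt a t i).naturality g) ((P t).extClass i M f)
  refine h.symm.trans ?_
  exact congr_arg _ ((P t).extClass_map f g)

/-- A chain map lifting the projection `R ⧸ a ^ s ⟶ R ⧸ a ^ t`. -/
def transition {t s : ℕ} (h : t ≤ s) : (P s).complex ⟶ (P t).complex :=
  ProjectiveResolution.lift (quotPowMap a h) (P s) (P t)

lemma transition_π {t s : ℕ} (h : t ≤ s) :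
    (transition P h).f 0 ≫ (P t).π.f 0 = (P s).π.f 0 ≫ quotPowMap a h :=
  ProjectiveResolution.lift_commutes_zero _ _ _

/-- Pulling back a cocycle along `transition`. -/
def pull {t s : ℕ} (h : t ≤ s) {i : ℕ} {M : ModuleCat.{u} R} (f : (P t).homCocycles i M) :
    (P s).homCocycles i M :=
  ⟨(transition P h).f i ≫ f.1, ProjectiveResolution.chainMap_comp_mem_homCocycles _ f.2⟩

lemma extClass_pull {t s : ℕ} (h : t ≤ s) {i : ℕ} {M : ModuleCat.{u} R}
    (f : (P t).homCocycles i M) :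
    ((Ext R (ModuleCat.{u} R) i).map (quotPowMap a h).op).app M ((P t).extClass i M f) =
      (P s).extClass i M (pull P h f) :=
  ProjectiveResolution.extClass_chainMap (P t) (P s) (transition P h) _ (transition_π P h) f

lemma cls_pull {t s : ℕ} (h : t ≤ s) {i : ℕ} {M : ModuleCat.{u} R}
    (f : (P t).homCocycles i M) : cls P s i M (pull P h f) = cls P t i M f := by
  have h1 : (Ext R (ModuleCat.{u} R) i).map (quotPowMap a h).op ≫ ofExt a s i = ofExt a t i :=
    colimit.w (diagram (idealPowersDiagram a) i) (homOfLE h).op.op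
  rw [cls, LinearMap.comp_apply, ← extClass_pull]
  exact ConcreteCategory.congr_hom (congr_app h1 M) ((P t).extClass i M f)

lemma cls_eq_zero {t i j : ℕ} {M : ModuleCat.{u} R} (f : (P t).homCocycles i M)
    (g : (P t).complex.X j ⟶ M) (h : f.1 = (P t).complex.d i j ≫ g) : cls P t i M f = 0 := by
  rw [cls, LinearMap.comp_apply, ((P t).extClass_eq_zero_iff f).2 ⟨j, g, h⟩, map_zero]

lemma exists_of_cls_eq_zero {t i : ℕ} {M : ModuleCat.{u} R} (f : (P t).homCocycles i M)
    (h : cls P t i M f = 0) : ∃ (s : ℕ) (hs : t ≤ s) (j : ℕ) (g : (P s).complex.X j ⟶ M),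
      (transition P hs).f i ≫ f.1 = (P s).complex.d i j ≫ g := by
  obtain ⟨k, p, q, hpq⟩ := Concrete.isColimit_exists_of_rep_eq _ (isColimitObj a i M)
    (i := op (op t)) (j := op (op t)) ((P t).extClass i M f) 0 (h.trans (map_zero _).symm)
  have hs : t ≤ k.unop.unop := leOfHom p.unop.unop
  refine ⟨k.unop.unop, hs, ?_⟩
  rw [map_zero] at hpq
  exact ((P _).extClass_eq_zero_iff (pull P hs f)).1 ((extClass_pull P hs f).symm.trans hpq)

/-- In positive degree, cocycles of trivial class become coboundaries. -/
lemma exists_of_cls_succ_eq_zero {t i : ℕ} {M : ModuleCat.{u} R}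
    (f : (P t).homCocycles (i + 1) M)
    (h : cls P t (i + 1) M f = 0) : ∃ (s : ℕ) (hs : t ≤ s) (g : (P s).complex.X i ⟶ M),
      (transition P hs).f (i + 1) ≫ f.1 = (P s).complex.d (i + 1) i ≫ g := by
  obtain ⟨s, hs, j, g, e⟩ := exists_of_cls_eq_zero P f h
  by_cases hj : j = i
  · subst hj; exact ⟨s, hs, g, e⟩
  · refine ⟨s, hs, 0, ?_⟩
    rw [e, (P s).complex.shape _ _ (by simpa using fun h => hj h), zero_comp, comp_zero]

instance (i : ℕ) : (localCohomology a i).Additive where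
  map_add {M N f g} := by
    ext z
    obtain ⟨t, z, rfl⟩ := exists_cls (fun t => projectiveResolution (quotPow a t)) z
    simp only [ModuleCat.hom_add, LinearMap.add_apply]
    erw [cls_map, cls_map, cls_map, ← map_add]
    congr 2

lemma map_smul_apply (i : ℕ) {M N : ModuleCat.{u} R} (r : R) (f : M ⟶ N)
    (z : (localCohomology a i).obj M) :
    (localCohomology a i).map (r • f) z = r • (localCohomology a i).map f z := by
  obtain ⟨t, z, rfl⟩ := exists_cls (fun t => projectiveResolution (quotPow a t)) z
  rw [cls_map, cls_map, ← map_smul]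
  congr 2

end Cocycles

variable {a}

section ShortExact

variable {S : ShortComplex (ModuleCat.{u} R)} (hS : S.ShortExact)
include hS

lemma exact_map (i : ℕ) (z : (localCohomology a i).obj S.X₂)
    (hz : (localCohomology a i).map S.g z = 0) : ∃ y, (localCohomology a i).map S.f y = z := by
  have := hS.mono_f
  have := hS.epi_g
  let P := fun t => projectiveResolution (quotPow a t)
  obtain ⟨t, f, rfl⟩ := exists_cls P z
  rw [cls_map] at hz
  obtain ⟨s, hs, j, g, e⟩ := exists_of_cls_eq_zero P _ hz
  let g' : (P s).complex.X j ⟶ S.X₂ := Projective.factorThru g S.g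
  have hg' : g' ≫ S.g = g := Projective.factorThru_comp _ _
  let k := hS.exact.liftFromProjective ((pull P hs f).1 - (P s).complex.d i j ≫ g') (by
    rw [Preadditive.sub_comp, Category.assoc, hg', ← e, pull, Category.assoc, sub_self])
  have hk : k ≫ S.f = (pull P hs f).1 - (P s).complex.d i j ≫ g' :=
    hS.exact.liftFromProjective_comp _ _
  have hk' : k ∈ (P s).homCocycles i S.X₁ := by
    rw [ProjectiveResolution.mem_homCocycles, ← cancel_mono S.f, Category.assoc, hk,
      Preadditive.comp_sub, ← Category.assoc, HomologicalComplex.d_comp_d, zero_comp, zero_comp,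
      sub_zero]
    exact (pull P hs f).2
  refine ⟨cls P s i _ ⟨k, hk'⟩, ?_⟩
  rw [cls_map, ← cls_pull P hs f, ← sub_eq_zero, ← map_sub]
  refine cls_eq_zero P _ (-g') ?_
  simp [hk]

lemma subsingleton_succ_X₁ (i : ℕ)
    (h₁ : Function.Surjective ((localCohomology a i).map S.g))
    (h₂ : Subsingleton ((localCohomology a (i + 1)).obj S.X₂)) :
    Subsingleton ((localCohomology a (i + 1)).obj S.X₁) := by
  have := hS.mono_f
  have := hS.epi_g
  let P := fun t => projectiveResolution (quotPow a t)
  refine subsingleton_of_forall_eq 0 fun z => ?_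
  obtain ⟨t, f, rfl⟩ := exists_cls P z
  obtain ⟨s, hs, g, e⟩ := exists_of_cls_succ_eq_zero P
    ⟨f.1 ≫ S.f, ProjectiveResolution.comp_mem_homCocycles f.2 _⟩ (Subsingleton.elim _ _)
  rw [← cls_pull P hs]
  replace e : (pull P hs f).1 ≫ S.f = (P s).complex.d (i + 1) i ≫ g :=
    (Category.assoc ..).trans e
  generalize pull P hs f = f at e
  have hg : g ≫ S.g ∈ (P s).homCocycles i S.X₃ := by
    rw [ProjectiveResolution.mem_homCocycles, ← Category.assoc, ← e, Category.assoc, S.zero,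
      comp_zero]
  obtain ⟨y, hy⟩ := h₁ (cls P s i _ ⟨_, hg⟩)
  obtain ⟨t', h, rfl⟩ := exists_cls P y
  rw [cls_map, ← cls_pull P (le_max_left s t'), ← cls_pull P (le_max_right s t'), ← sub_eq_zero,
    ← map_sub] at hy
  obtain ⟨r, hr, j, k, e'⟩ := exists_of_cls_eq_zero P _ hy
  let H := pull P hr (pull P (le_max_right s t') h)
  let G := (transition P hr).f i ≫ (transition P (le_max_left s t')).f i ≫ g
  let k' : (P r).complex.X j ⟶ S.X₂ := Projective.factorThru k S.g
  have hk' : k' ≫ S.g = k := Projective.factorThru_comp _ _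
  let l := hS.exact.liftFromProjective (G - H.1 + (P r).complex.d i j ≫ k') (by
    rw [Preadditive.add_comp, Category.assoc, hk', ← e']
    simp [pull, G, H])
  have hl : l ≫ S.f = G - H.1 + (P r).complex.d i j ≫ k' := hS.exact.liftFromProjective_comp _ _
  rw [← cls_pull P (le_max_left s t'), ← cls_pull P hr]
  refine cls_eq_zero P _ l ?_
  rw [← cancel_mono S.f, Category.assoc, hl, Preadditive.comp_add, Preadditive.comp_sub,
    ProjectiveResolution.mem_homCocycles.1 H.2]
  simp [pull, G, e]

lemma map_g_surjective (i : ℕ)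
    (h : Subsingleton ((localCohomology a (i + 1)).obj S.X₁)) :
    Function.Surjective ((localCohomology a i).map S.g) := by
  have := hS.mono_f
  have := hS.epi_g
  let P := fun t => projectiveResolution (quotPow a t)
  intro z
  obtain ⟨t, f, rfl⟩ := exists_cls P z
  let f' : (P t).complex.X i ⟶ S.X₂ := Projective.factorThru f.1 S.g
  have hf' : f' ≫ S.g = f.1 := Projective.factorThru_comp _ _
  let l := hS.exact.liftFromProjective ((P t).complex.d (i + 1) i ≫ f') (by
    rw [Category.assoc, hf', ProjectiveResolution.mem_homCocycles.1 f.2])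
  have hl : l ≫ S.f = (P t).complex.d (i + 1) i ≫ f' := hS.exact.liftFromProjective_comp _ _
  have hl' : l ∈ (P t).homCocycles (i + 1) S.X₁ := by
    rw [ProjectiveResolution.mem_homCocycles, ← cancel_mono S.f, Category.assoc, hl]
    simp
  obtain ⟨s, hs, g, e⟩ := exists_of_cls_succ_eq_zero P ⟨l, hl'⟩ (Subsingleton.elim _ _)
  let w := (transition P hs).f i ≫ f' - g ≫ S.f
  have hw : w ∈ (P s).homCocycles i S.X₂ := by
    rw [ProjectiveResolution.mem_homCocycles, Preadditive.comp_sub, ← Category.assoc,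
      ← Category.assoc, ← e, ← HomologicalComplex.Hom.comm, Category.assoc, Category.assoc, hl,
      sub_self]
  refine ⟨cls P s i _ ⟨w, hw⟩, ?_⟩
  rw [cls_map, ← cls_pull P hs f]
  congr 2
  simp [w, hf']

end ShortExact
lemma subsingleton_of_injective (i : ℕ) (E : ModuleCat.{u} R) [Injective E] :
    Subsingleton ((localCohomology a (i + 1)).obj E) := by
  let P := fun t => projectiveResolution (quotPow a t)
  refine subsingleton_of_forall_eq 0 fun z => ?_
  obtain ⟨t, f, rfl⟩ := exists_cls P z
  exact cls_eq_zero P f (((P t).exact_succ i).descToInjective f.1 f.2)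
    (((P t).exact_succ i).comp_descToInjective f.1 f.2).symm

lemma smul_cls (P : ∀ t, ProjectiveResolution (quotPow a t)) {t i : ℕ} {M : ModuleCat.{u} R}
    (f : (P t).homCocycles i M) {r : R} (hr : r ∈ a ^ t) : r • cls P t i M f = 0 := by
  have hπ : (r • 𝟙 (P t).complex) ≫ (P t).π = 0 := by
    apply HomologicalComplex.to_single_hom_ext
    have h0 : r • 𝟙 (quotPow a t) = 0 := by
      ext x
      obtain ⟨x, rfl⟩ := Ideal.Quotient.mk_surjective x
      exact Ideal.Quotient.eq_zero_iff_mem.2 (Ideal.mul_mem_right x _ hr)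
    let ε : (P t).complex.X 0 ⟶ quotPow a t := (P t).π.f 0
    have h1 : (r • 𝟙 _) ≫ ε = ε ≫ (r • 𝟙 _) := by
      rw [Linear.smul_comp, Linear.comp_smul, Category.id_comp, Category.comp_id]
    exact h1.trans (by rw [h0, comp_zero]; rfl)
  let H := ProjectiveResolution.liftHomotopyZero _ hπ
  rw [← map_smul]
  refine cls_eq_zero P _ (H.hom _ i ≫ f.1) (j := (ComplexShape.down ℕ).next i) ?_
  have h2 : prevD i H.hom ≫ f.1 = 0 := by
    rw [prevD_eq H.hom (j' := i + 1) rfl, Category.assoc,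
      ProjectiveResolution.mem_homCocycles.1 f.2, comp_zero]
  have h3 : dNext i H.hom = (P t).complex.d i ((ComplexShape.down ℕ).next i) ≫ H.hom _ i := rfl
  have h1 : (r • 𝟙 _) ≫ f.1 = (dNext i H.hom + prevD i H.hom + 0) ≫ f.1 :=
    congr_arg (· ≫ f.1) (H.comm i)
  rw [Linear.smul_comp, Category.id_comp, Preadditive.add_comp, Preadditive.add_comp, h2, h3,
    zero_comp, add_zero, add_zero, Category.assoc] at h1
  exact h1

/-- If `x ∈ a` acts bijectively on `N`, then the local cohomology of `N` vanishes. -/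
lemma subsingleton_of_bijective (i : ℕ) (N : ModuleCat.{u} R) {x : R} (hx : x ∈ a)
    (hN : Function.Bijective fun m : N => x • m) :
    Subsingleton ((localCohomology a i).obj N) := by
  refine subsingleton_of_forall_eq 0 fun z => ?_
  obtain ⟨t, f, rfl⟩ := exists_cls (fun t => projectiveResolution (quotPow a t)) z
  have h : IsIso ((x ^ t) • 𝟙 N) := by
    refine (ConcreteCategory.isIso_iff_bijective _).2 ?_
    convert hN.iterate t using 2
    ext m
    rw [smul_iterate]
    rfl
  refine (ConcreteCategory.isIso_iff_bijective
    ((localCohomology a i).map ((x ^ t) • 𝟙 N))).1 inferInstance |>.1 ?_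
  rw [map_smul_apply, map_zero, CategoryTheory.Functor.map_id, ModuleCat.id_apply,
    smul_cls _ _ (Ideal.pow_mem_pow hx t)]

variable (a) in
/-- Every element of `M` is annihilated by a power of `a`. -/
def IsPowTorsion (M : Type*) [AddCommGroup M] [Module R M] : Prop :=
  ∀ m : M, ∃ k, ∀ r ∈ a ^ k, r • m = 0

variable (a) in
/-- The submodule of elements annihilated by a power of `a`. -/
def powTorsion (M : Type*) [AddCommGroup M] [Module R M] : Submodule R M where
  carrier := {m | ∃ k, ∀ r ∈ a ^ k, r • m = 0}
  add_mem' := by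
    rintro m n ⟨k, hk⟩ ⟨l, hl⟩
    refine ⟨max k l, fun r hr => ?_⟩
    rw [smul_add, hk r (Ideal.pow_le_pow_right (le_max_left _ _) hr),
      hl r (Ideal.pow_le_pow_right (le_max_right _ _) hr), add_zero]
  zero_mem' := ⟨0, by simp⟩
  smul_mem' c m := by
    rintro ⟨k, hk⟩
    exact ⟨k, fun r hr => by rw [smul_comm, hk r hr, smul_zero]⟩

lemma isPowTorsion_powTorsion (M : Type*) [AddCommGroup M] [Module R M] :
    IsPowTorsion a (powTorsion a M) := fun ⟨_, k, hk⟩ =>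
  ⟨k, fun r hr => Subtype.ext (hk r hr)⟩

lemma IsPowTorsion.of_surjective {M N : Type*} [AddCommGroup M] [Module R M] [AddCommGroup N]
    [Module R N] (hM : IsPowTorsion a M) (f : M →ₗ[R] N) (hf : Function.Surjective f) :
    IsPowTorsion a N := fun n => by
  obtain ⟨m, rfl⟩ := hf n
  obtain ⟨k, hk⟩ := hM m
  exact ⟨k, fun r hr => by rw [← map_smul, hk r hr, map_zero]⟩

lemma map_g_surjective_zero {S : ShortComplex (ModuleCat.{u} R)} (hS : S.ShortExact)
    (hE : IsPowTorsion a S.X₂) : Function.Surjective ((localCohomology a 0).map S.g) := by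
  have := hS.epi_g
  let P := fun t => projectiveResolution (quotPow a t)
  intro z
  obtain ⟨t, f, rfl⟩ := exists_cls P z
  obtain ⟨φ, hφ⟩ : ∃ φ : quotPow a t ⟶ S.X₃, (P t).π.f 0 ≫ φ = f.1 :=
    ⟨_, (CokernelCofork.IsColimit.desc' (P t).isColimitCokernelCofork f.1 f.2).2⟩
  obtain ⟨e, he⟩ := (ModuleCat.epi_iff_surjective _).1 this
    (φ (Submodule.Quotient.mk 1 : R ⧸ a ^ t))
  obtain ⟨k, hk⟩ := hE e
  let s := max t k
  let ψ : quotPow a s ⟶ S.X₂ := ModuleCat.ofHom (Submodule.liftQ (a ^ s)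
    (LinearMap.toSpanSingleton R S.X₂ e) fun r hr => hk r (Ideal.pow_le_pow_right le_sup_right hr))
  have hψ : ψ ≫ S.g = quotPowMap a le_sup_left ≫ φ := by
    ext x
    obtain ⟨x, rfl⟩ := Ideal.Quotient.mk_surjective x
    refine (map_smul S.g.hom x e).trans ((congr_arg (x • ·) he).trans ?_)
    refine (map_smul φ.hom x _).symm.trans (congr_arg φ ?_)
    exact congr_arg (Submodule.Quotient.mk : R → R ⧸ a ^ t) (mul_one x)
  let ε : (P s).complex.X 0 ⟶ quotPow a s := (P s).π.f 0
  have hε : (P s).complex.d 1 0 ≫ ε = 0 := ProjectiveResolution.complex_d_comp_π_f_zero _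
  have hw : ε ≫ ψ ∈ (P s).homCocycles 0 S.X₂ := by
    rw [ProjectiveResolution.mem_homCocycles, ← Category.assoc, hε, zero_comp]
  refine ⟨cls P s 0 _ ⟨_, hw⟩, ?_⟩
  rw [cls_map, ← cls_pull P (le_sup_left : t ≤ s) f]
  refine congr_arg _ (Subtype.ext ?_)
  have ht : (transition P le_sup_left).f 0 ≫ (P t).π.f 0 = ε ≫ quotPowMap a le_sup_left :=
    transition_π P _
  change (ε ≫ ψ) ≫ S.g = (transition P le_sup_left).f 0 ≫ f.1
  rw [← hφ, Category.assoc, hψ]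
  exact ((Category.assoc ..).symm.trans (congr_arg (· ≫ φ) ht.symm)).trans (Category.assoc ..)

lemma injective_powTorsion [IsNoetherianRing R] (J : Type u) [AddCommGroup J] [Module R J]
    [Module.Injective R J] : Module.Injective R (powTorsion a J) := by
  refine Module.Baer.injective fun I g => ?_
  obtain ⟨k, hk⟩ : ∃ k, ∀ r ∈ a ^ k, ∀ x : I, r • g x = 0 := by
    have hfg : (⊤ : Submodule R I).FG := Module.Finite.fg_top
    obtain ⟨s, hs⟩ := hfg
    choose k hk using fun x : I => (g x).2
    refine ⟨s.sup k, fun r hr x => ?_⟩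
    have hx : x ∈ Submodule.span R (s : Set I) := by rw [hs]; trivial
    induction hx using Submodule.span_induction with
    | mem x hx => exact Subtype.ext (hk x r (Ideal.pow_le_pow_right (Finset.le_sup hx) hr))
    | zero => simp
    | add x y _ _ hx hy => rw [map_add, smul_add, hx, hy, add_zero]
    | smul c x _ hx => rw [map_smul, smul_comm, hx, smul_zero]
  obtain ⟨l, hl⟩ := a.exists_pow_inf_eq_pow_smul I
  let N := l + k
  let q : I →ₗ[R] R ⧸ a ^ N := (a ^ N).mkQ ∘ₗ I.subtype
  have hq : LinearMap.ker q ≤ LinearMap.ker g := by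
    rintro ⟨x, hx⟩ h
    have hxN : x ∈ a ^ N := Ideal.Quotient.eq_zero_iff_mem.1 h
    have h1 : x ∈ a ^ (N - l) • (a ^ l • ⊤ ⊓ I) := by
      rw [← hl N (by omega)]
      exact ⟨by simpa using hxN, hx⟩
    have h2 : x ∈ a ^ k • I := by
      rw [show N - l = k by omega] at h1
      exact Submodule.smul_mono le_rfl inf_le_right h1
    have h3 : ∀ y ∈ a ^ k • I, ∃ hy : y ∈ I, g ⟨y, hy⟩ = 0 := by
      intro y hy
      induction hy using Submodule.smul_induction_on' with
      | smul r hr n hn =>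
        exact ⟨I.smul_mem r hn, (map_smul g r ⟨n, hn⟩).trans (hk r hr ⟨n, hn⟩)⟩
      | add x _ y _ hx hy =>
        obtain ⟨hx, hx'⟩ := hx
        obtain ⟨hy, hy'⟩ := hy
        refine ⟨add_mem hx hy, ?_⟩
        exact (map_add g ⟨x, hx⟩ ⟨y, hy⟩).trans (by rw [hx', hy', add_zero])
    exact (h3 x h2).2
  obtain ⟨h, hh⟩ := Module.Injective.out (R := R) (Q := J)
    ((LinearMap.ker q).liftQ q le_rfl)
    (LinearMap.ker_eq_bot.1 (Submodule.ker_liftQ_eq_bot _ _ _ le_rfl))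
    ((powTorsion a J).subtype ∘ₗ (LinearMap.ker q).liftQ g hq)
  have hmem : ∀ y, h y ∈ powTorsion a J := fun y => ⟨N, fun r hr => by
    obtain ⟨y, rfl⟩ := Ideal.Quotient.mk_surjective y
    rw [← map_smul]
    refine (congr_arg h ?_).trans (map_zero h)
    exact Ideal.Quotient.eq_zero_iff_mem.2 (Ideal.mul_mem_right y _ hr)⟩
  refine ⟨(h.codRestrict _ hmem) ∘ₗ (a ^ N).mkQ, fun x hx => Subtype.ext ?_⟩
  exact hh (Submodule.Quotient.mk ⟨x, hx⟩)

lemma exists_shortExact_isPowTorsion [IsNoetherianRing R] (M : ModuleCat.{u} R)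
    (hM : IsPowTorsion a M) : ∃ S : ShortComplex (ModuleCat.{u} R), S.ShortExact ∧ S.X₁ = M ∧
      Injective S.X₂ ∧ IsPowTorsion a S.X₂ := by
  let J := Injective.under M
  have : Module.Injective R J :=
    Module.injective_module_of_injective_object (inj := (inferInstance : Injective J))
  have hE : Injective (ModuleCat.of R (powTorsion a J)) :=
    (Module.injective_iff_injective_object _ _).1 (injective_powTorsion (a := a) J)
  let f : M →ₗ[R] powTorsion a J := (Injective.ι M).hom.codRestrict _ fun m => by
    obtain ⟨k, hk⟩ := hM m
    exact ⟨k, fun r hr => by rw [← map_smul, hk r hr, map_zero]⟩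
  refine ⟨ModuleCat.shortComplexOfCompEqZero f (LinearMap.range f).mkQ
    (LinearMap.range_mkQ_comp f),
    ModuleCat.shortComplex_shortExact _ (LinearMap.exact_map_mkQ_range f) ?_
      (Submodule.mkQ_surjective _), rfl, hE, isPowTorsion_powTorsion _⟩
  exact fun x y h => (ModuleCat.mono_iff_injective (Injective.ι M)).1 inferInstance
    (congr_arg Subtype.val h)

lemma subsingleton_of_isPowTorsion [IsNoetherianRing R] (i : ℕ) (M : ModuleCat.{u} R)
    (hM : IsPowTorsion a M) : Subsingleton ((localCohomology a (i + 1)).obj M) := by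
  induction i generalizing M with
  | zero =>
    obtain ⟨S, hS, rfl, hE, hE'⟩ := exists_shortExact_isPowTorsion M hM
    exact subsingleton_succ_X₁ hS 0 (map_g_surjective_zero hS hE') (subsingleton_of_injective _ _)
  | succ i ih =>
    obtain ⟨S, hS, rfl, hE, hE'⟩ := exists_shortExact_isPowTorsion M hM
    have := ih S.X₃ (hE'.of_surjective S.g.hom hS.moduleCat_surjective_g)
    exact subsingleton_succ_X₁ hS (i + 1) (fun y => ⟨0, Subsingleton.elim _ _⟩)
      (subsingleton_of_injective _ _)

lemma subsingleton_X₂ {S : ShortComplex (ModuleCat.{u} R)} (hS : S.ShortExact) {i : ℕ}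
    (h₁ : Subsingleton ((localCohomology a i).obj S.X₁))
    (h₃ : Subsingleton ((localCohomology a i).obj S.X₃)) :
    Subsingleton ((localCohomology a i).obj S.X₂) := by
  refine subsingleton_of_forall_eq 0 fun z => ?_
  obtain ⟨y, rfl⟩ := exact_map hS i z (Subsingleton.elim _ _)
  rw [Subsingleton.elim y 0, map_zero]

lemma isPowTorsion_of_generators {G : Set R} (hG : Ideal.span G = a) (ha : a.FG) {M : Type*}
    [AddCommGroup M] [Module R M] (h : ∀ y ∈ G, ∀ m : M, ∃ k : ℕ, y ^ k • m = 0) :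
    IsPowTorsion a M := fun m => by
  obtain ⟨k, hk⟩ := Ideal.exists_pow_le_of_le_radical_of_fg
    (J := LinearMap.ker (LinearMap.toSpanSingleton R M m))
    (show a ≤ _ by
      rw [← hG, Ideal.span_le]
      intro y hy
      obtain ⟨k, hk⟩ := h y hy m
      exact ⟨k, hk⟩) ha
  exact ⟨k, fun r hr => hk hr⟩

/-- Local cohomology vanishes above the number of generators not acting locally nilpotently. -/
lemma subsingleton_of_length_lt [IsNoetherianRing R] {G : Set R} (hG : Ideal.span G = a)
    (l : List R) (hl : ∀ x ∈ l, x ∈ a) (M : ModuleCat.{u} R)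
    (h : ∀ y ∈ G, y ∈ l ∨ ∀ m : M, ∃ k : ℕ, y ^ k • m = 0) (i : ℕ) (hi : l.length < i) :
    Subsingleton ((localCohomology a i).obj M) := by
  induction l generalizing M i with
  | nil =>
    obtain _ | i := i
    · simp at hi
    · exact subsingleton_of_isPowTorsion i M (isPowTorsion_of_generators hG
        (IsNoetherian.noetherian a) fun y hy => (h y hy).resolve_left (by simp))
  | cons x l ih =>
    obtain _ | i := i
    · simp at hi
    replace hi : l.length < i := by simpa using hi
    replace ih := ih fun y hy => hl y (by simp [hy])
    let N := LocalizedModule (Submonoid.powers x) M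
    let φ : M →ₗ[R] N := LocalizedModule.mkLinearMap _ M
    have hN := subsingleton_of_bijective (a := a) (i + 1) (ModuleCat.of R N) (hl x (by simp))
      ((Module.End.isUnit_iff _).1 (IsLocalizedModule.map_units (S := .powers x) φ
        ⟨x, Submonoid.mem_powers x⟩))
    have hk := ih (ModuleCat.of R (LinearMap.ker φ)) (fun y hy => by
      by_cases hyx : y = x
      · subst hyx
        refine .inr fun m => ?_
        obtain ⟨_, ⟨k, rfl⟩, hk⟩ :=
          (IsLocalizedModule.mem_ker_iff (.powers y) (g := φ)).1 m.2
        exact ⟨k, Subtype.ext hk⟩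
      · refine (h y hy).imp (fun h => by simpa [hyx] using h) fun h m => ?_
        obtain ⟨k, hk⟩ := h m
        exact ⟨k, Subtype.ext hk⟩) (i + 1) (by omega)
    have hc := ih (ModuleCat.of R (N ⧸ LinearMap.range φ)) (fun y hy => by
      by_cases hyx : y = x
      · subst hyx
        refine .inr fun m => ?_
        obtain ⟨m, rfl⟩ := Submodule.mkQ_surjective _ m
        obtain ⟨⟨m', _, ⟨k, rfl⟩⟩, hm⟩ := IsLocalizedModule.surj (.powers y) φ m
        refine ⟨k, ?_⟩
        rw [← map_smul]
        exact (Submodule.Quotient.mk_eq_zero _).2 ⟨m', hm.symm⟩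
      · refine (h y hy).imp (fun h => by simpa [hyx] using h) fun h m => ?_
        obtain ⟨m, rfl⟩ := Submodule.mkQ_surjective _ m
        induction m using LocalizedModule.induction_on with
        | h m s =>
          obtain ⟨k, hk⟩ := h m
          refine ⟨k, ?_⟩
          rw [← map_smul, LocalizedModule.smul'_mk, hk, LocalizedModule.zero_mk, map_zero]) i hi
    have hr := subsingleton_succ_X₁ (ModuleCat.shortComplex_shortExact
      (ModuleCat.shortComplexOfCompEqZero (LinearMap.range φ).subtype (LinearMap.range φ).mkQ
        (LinearMap.ext fun x => by simp))
      (LinearMap.exact_subtype_mkQ _) (Submodule.subtype_injective _)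
      (Submodule.mkQ_surjective _)) i (fun y => ⟨0, hc.elim _ _⟩) hN
    exact subsingleton_X₂ (ModuleCat.shortComplex_shortExact
      (ModuleCat.shortComplexOfCompEqZero (LinearMap.ker φ).subtype φ.rangeRestrict
        (LinearMap.ext fun x => Subtype.ext x.2))
      (fun m => Subtype.ext_iff.trans ⟨fun hm => ⟨⟨m, hm⟩, rfl⟩, by rintro ⟨y, rfl⟩; exact y.2⟩)
      (Submodule.subtype_injective _) φ.surjective_rangeRestrict) hk hr

lemma exists_subsingleton_of_lt [IsNoetherianRing R] (a : Ideal R) :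
    ∃ b, ∀ (M : ModuleCat.{u} R) (i : ℕ), b < i → Subsingleton ((localCohomology a i).obj M) := by
  obtain ⟨s, hs⟩ : a.FG := IsNoetherian.noetherian a
  exact ⟨_, fun M i hi => subsingleton_of_length_lt hs s.toList
    (fun x hx => hs ▸ Ideal.subset_span (by simpa using hx)) M (fun y hy => .inl (by simpa using hy))
    i hi⟩

end localCohomology

namespace CategoryTheory.ProjectiveResolution

variable {R : Type u} [CommRing R] [IsNoetherianRing R]

lemma exists_exact {X Y : ModuleCat.{u} R} (f : X ⟶ Y) :
    ∃ (P : ModuleCat.{u} R) (d : P ⟶ X) (w : d ≫ f = 0), (ShortComplex.mk d f w).Exact ∧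
      Projective P ∧ (Module.Finite R X → Module.Finite R P) := by
  suffices ∃ (P : ModuleCat.{u} R) (d : P →ₗ[R] LinearMap.ker f.hom), Function.Surjective d ∧
      Module.Projective R P ∧ (Module.Finite R X → Module.Finite R P) by
    obtain ⟨P, d, hd, hP, hf⟩ := this
    refine ⟨P, ModuleCat.ofHom ((LinearMap.ker f.hom).subtype ∘ₗ d), ?_, ?_, ?_, hf⟩
    · ext x
      exact (d x).2
    · refine ModuleCat.shortComplex_exact _ fun x => ⟨fun hx => ?_, ?_⟩
      · obtain ⟨y, hy⟩ := hd ⟨x, hx⟩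
        exact ⟨y, congr_arg Subtype.val hy⟩
      · rintro ⟨y, rfl⟩
        exact (d y).2
    · exact (IsProjective.iff_projective (P := P)).1 hP
  by_cases h : Module.Finite R X
  · obtain ⟨n, d, hd⟩ := Module.Finite.exists_fin' R (LinearMap.ker f.hom)
    exact ⟨ModuleCat.of R (Fin n → R), d, hd, inferInstanceAs (Module.Projective R (Fin n → R)),
      fun _ => inferInstanceAs (Module.Finite R (Fin n → R))⟩
  · exact ⟨ModuleCat.of R (LinearMap.ker f.hom →₀ R), Finsupp.linearCombination R id,
      Finsupp.linearCombination_id_surjective R _,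
      inferInstanceAs (Module.Projective R (LinearMap.ker f.hom →₀ R)), fun h' => (h h').elim⟩

/-- A projective object with a map onto the kernel of `f`. -/
def cover {X Y : ModuleCat.{u} R} (f : X ⟶ Y) :
    Σ' (P : ModuleCat.{u} R) (d : P ⟶ X), d ≫ f = 0 :=
  ⟨(exists_exact f).choose, (exists_exact f).choose_spec.choose,
    (exists_exact f).choose_spec.choose_spec.choose⟩

lemma cover_spec {X Y : ModuleCat.{u} R} (f : X ⟶ Y) :
    (ShortComplex.mk (cover f).2.1 f (cover f).2.2).Exact ∧
      Projective (cover f).1 ∧ (Module.Finite R X → Module.Finite R (cover f).1) :=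
  (exists_exact f).choose_spec.choose_spec.choose_spec

/-- The complex underlying `ofFinite`. -/
def ofFiniteComplex (Z : ModuleCat.{u} R) : ChainComplex (ModuleCat.{u} R) ℕ :=
  ChainComplex.mk' _ _ (cover (cover (0 : Z ⟶ Z)).2.1).2.1 fun f => cover f

lemma ofFiniteComplex_d_1_0 (Z : ModuleCat.{u} R) :
    (ofFiniteComplex Z).d 1 0 = (cover (cover (0 : Z ⟶ Z)).2.1).2.1 :=
  ChainComplex.mk'_d_1_0 ..

/-- The terms of `ofFiniteComplex` are given by `cover`. -/
def ofFiniteComplexXIso (Z : ModuleCat.{u} R) (n : ℕ) :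
    (ofFiniteComplex Z).X (n + 2) ≅ (cover ((ofFiniteComplex Z).d (n + 1) n)).1 :=
  ChainComplex.mk'XIso _ _ _ (fun f => cover f) n

lemma ofFiniteComplex_d (Z : ModuleCat.{u} R) (n : ℕ) :
    (ofFiniteComplex Z).d (n + 2) (n + 1) =
      (ofFiniteComplexXIso Z n).hom ≫ (cover ((ofFiniteComplex Z).d (n + 1) n)).2.1 :=
  ChainComplex.mk'_d ..

lemma ofFiniteComplex_exactAt_succ (Z : ModuleCat.{u} R) (n : ℕ) :
    (ofFiniteComplex Z).ExactAt (n + 1) := by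
  rw [HomologicalComplex.exactAt_iff' _ (n + 1 + 1) (n + 1) n (by simp) (by simp)]
  refine (ShortComplex.exact_iff_of_iso ?_).2 (cover_spec ((ofFiniteComplex Z).d (n + 1) n)).1
  exact ShortComplex.isoMk (ofFiniteComplexXIso Z n) (Iso.refl _) (Iso.refl _)
    ((ofFiniteComplex_d Z n).symm.trans (Category.comp_id _).symm)
    ((Category.id_comp _).trans (Category.comp_id _).symm)

lemma ofFiniteComplex_projective (Z : ModuleCat.{u} R) (n : ℕ) :
    Projective ((ofFiniteComplex Z).X n) := by
  obtain _ | _ | n := n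
  · exact (cover_spec (0 : Z ⟶ Z)).2.1
  · exact (cover_spec (cover (0 : Z ⟶ Z)).2.1).2.1
  · exact Projective.of_iso (ofFiniteComplexXIso Z n).symm (cover_spec _).2.1

lemma ofFiniteComplex_finite (Z : ModuleCat.{u} R) [Module.Finite R Z] (n : ℕ) :
    Module.Finite R ((ofFiniteComplex Z).X n) := by
  have h0 := (cover_spec (0 : Z ⟶ Z)).2.2 inferInstance
  obtain _ | n := n
  · exact h0
  induction n with
  | zero => exact (cover_spec (cover (0 : Z ⟶ Z)).2.1).2.2 h0
  | succ n ih =>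
    have := (cover_spec ((ofFiniteComplex Z).d (n + 1) n)).2.2 ih
    exact Module.Finite.equiv (ofFiniteComplexXIso Z n).symm.toLinearEquiv

/-- A projective resolution over a Noetherian ring, with finitely generated terms if the
module is finitely generated. -/
def ofFinite (Z : ModuleCat.{u} R) : ProjectiveResolution Z where
  complex := ofFiniteComplex Z
  projective := ofFiniteComplex_projective Z
  π := (ChainComplex.toSingle₀Equiv _ _).symm ⟨(cover (0 : Z ⟶ Z)).2.1, by
    rw [ofFiniteComplex_d_1_0]
    exact (cover (cover (0 : Z ⟶ Z)).2.1).2.2⟩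
  quasiIso := ⟨fun n => by
    cases n
    · rw [ChainComplex.quasiIsoAt₀_iff, ShortComplex.quasiIso_iff_of_zeros']
      · have : Epi (cover (0 : Z ⟶ Z)).2.1 :=
          (cover_spec (0 : Z ⟶ Z)).1.epi_f rfl
        refine (ShortComplex.exact_and_epi_g_iff_of_iso ?_).2
          ⟨(cover_spec (cover (0 : Z ⟶ Z)).2.1).1, this⟩
        exact ShortComplex.isoMk (Iso.refl _) (Iso.refl _) (Iso.refl _)
          ((Category.id_comp _).trans
            ((ofFiniteComplex_d_1_0 Z).symm.trans (Category.comp_id _).symm))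
          ((Category.id_comp _).trans (Category.comp_id _).symm)
      all_goals rfl
    · rw [quasiIsoAt_iff_exactAt']
      · apply ofFiniteComplex_exactAt_succ
      · apply ChainComplex.exactAt_succ_single_obj⟩

end CategoryTheory.ProjectiveResolution

namespace localCohomology

variable {R : Type u} [CommRing R] {a : Ideal R}

section Free

variable (ι : Type u)

/-- The inclusion of a coordinate into a free module. -/
abbrev freeι (s : ι) : ModuleCat.of R R ⟶ ModuleCat.of R (ι →₀ R) :=
  ModuleCat.ofHom (Finsupp.lsingle s)

/-- The projection of a free module to a coordinate. -/
abbrev freeπ (s : ι) : ModuleCat.of R (ι →₀ R) ⟶ ModuleCat.of R R :=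
  ModuleCat.ofHom (Finsupp.lapply s)

variable {ι}

lemma exists_comp_sum_eq {X : ModuleCat.{u} R} [Module.Finite R X]
    (f : X ⟶ ModuleCat.of R (ι →₀ R)) :
    ∃ S : Finset ι, f ≫ ∑ s ∈ S, freeπ ι s ≫ freeι ι s = f := by
  classical
  obtain ⟨T, hT⟩ := Module.Finite.fg_top (R := R) (M := X)
  refine ⟨T.biUnion fun x => (f.hom x).support, ModuleCat.hom_ext ?_⟩
  refine LinearMap.ext_on hT fun x hx => ?_
  change (∑ s ∈ _, freeπ ι s ≫ freeι ι s).hom (f.hom x) = f.hom x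
  rw [ModuleCat.hom_sum, LinearMap.sum_apply]
  conv_rhs => rw [← Finsupp.sum_single (f.hom x)]
  exact (Finsupp.sum_of_support_subset _ (Finset.subset_biUnion_of_mem
    (fun x => (f.hom x).support) hx) _ fun _ _ => Finsupp.single_zero _).symm

lemma exists_eq_sum_map [IsNoetherianRing R] (i : ℕ)
    (z : (localCohomology a i).obj (ModuleCat.of R (ι →₀ R))) : ∃ S : Finset ι,
    z = ∑ s ∈ S, (localCohomology a i).map (freeι ι s)
      ((localCohomology a i).map (freeπ ι s) z) := by
  obtain ⟨t, f, hf⟩ := exists_cls (fun t => ProjectiveResolution.ofFinite (quotPow a t)) z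
  have : Module.Finite R (quotPow a t) :=
    inferInstanceAs (Module.Finite R (R ⧸ a ^ t))
  have : Module.Finite R ((ProjectiveResolution.ofFinite (quotPow a t)).complex.X i) :=
    ProjectiveResolution.ofFiniteComplex_finite _ _
  obtain ⟨S, hS⟩ := exists_comp_sum_eq f.1
  refine ⟨S, ?_⟩
  have h : (localCohomology a i).map (∑ s ∈ S, freeπ ι s ≫ freeι ι s) z = z := by
    rw [← hf, cls_map]
    exact congr_arg _ (Subtype.ext hS)
  refine h.symm.trans ?_
  rw [Functor.map_sum]
  change ModuleCat.Hom.hom _ z = _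
  rw [ModuleCat.hom_sum, LinearMap.sum_apply]
  exact Finset.sum_congr rfl fun s _ =>
    ConcreteCategory.congr_hom ((localCohomology a i).map_comp _ _) z

variable (M : ModuleCat.{u} R)

/-- The standard presentation of a module by a free module. -/
abbrev freeCover : ShortComplex (ModuleCat.{u} R) where
  X₁ := ModuleCat.of R (LinearMap.ker (Finsupp.linearCombination R (id : M → M)))
  X₂ := ModuleCat.of R (M →₀ R)
  X₃ := M
  f := ModuleCat.ofHom (Submodule.subtype _)
  g := ModuleCat.ofHom (Finsupp.linearCombination R id)
  zero := ModuleCat.hom_ext (LinearMap.ext fun x => x.2)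

lemma freeCover_shortExact : (freeCover M).ShortExact :=
  ModuleCat.shortComplex_shortExact _
    (fun m => ⟨fun hm => ⟨⟨m, hm⟩, rfl⟩, by rintro ⟨y, rfl⟩; exact y.2⟩)
    (Submodule.subtype_injective _) (Finsupp.linearCombination_id_surjective R M)

variable [IsNoetherianRing R] {n : ℕ}

/-- Local cohomology vanishes above the cohomological dimension of the ring. -/
lemma subsingleton_of_lt
    (h : ∀ i, n < i → Subsingleton ((localCohomology a i).obj (ModuleCat.of R R)))
    (i : ℕ) (hi : n < i) : Subsingleton ((localCohomology a i).obj M) := by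
  obtain ⟨b, hb⟩ := exists_subsingleton_of_lt a
  suffices ∀ k i, n < i → b < i + k → ∀ M, Subsingleton ((localCohomology a i).obj M) from
    this (b + 1) i hi (by omega) M
  intro k
  induction k with
  | zero => exact fun i _ hi M => hb M i hi
  | succ k ih =>
    intro i hi hb M
    have := ih (i + 1) (by omega) (by omega) (freeCover M).X₁
    have hF : Subsingleton ((localCohomology a i).obj (freeCover M).X₂) := by
      refine subsingleton_of_forall_eq 0 fun z => ?_
      obtain ⟨S, hS⟩ := exists_eq_sum_map i z
      refine hS.trans (Finset.sum_eq_zero fun s _ => ?_)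
      have := h i hi
      refine (congr_arg _ (Subsingleton.elim _ 0)).trans (map_zero _)
    exact (map_g_surjective (freeCover_shortExact M) i this).subsingleton

end Free

section Tensor

variable (a) (n : ℕ)

/-- The natural map from the tensor product with the local cohomology of the ring. -/
def tensorMap (M : ModuleCat.{u} R) :
    (localCohomology a n).obj (ModuleCat.of R R) ⊗[R] M →ₗ[R] (localCohomology a n).obj M :=
  TensorProduct.lift (LinearMap.flip
    { toFun := fun m => ((localCohomology a n).map
        (ModuleCat.ofHom (LinearMap.toSpanSingleton R M m))).hom
      map_add' := fun m m' => by
        rw [LinearMap.toSpanSingleton_add, ModuleCat.ofHom_add, Functor.map_add, ModuleCat.hom_add]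
      map_smul' := fun r m => by
        ext z
        rw [LinearMap.toSpanSingleton_smul]
        exact map_smul_apply n r (ModuleCat.ofHom (LinearMap.toSpanSingleton R M m)) z })

variable {a n}

lemma tensorMap_tmul {M : ModuleCat.{u} R} (z : (localCohomology a n).obj (ModuleCat.of R R))
    (m : M) : tensorMap a n M (z ⊗ₜ m) = (localCohomology a n).map
      (ModuleCat.ofHom (LinearMap.toSpanSingleton R M m)) z :=
  rfl

lemma map_tensorMap {M N : ModuleCat.{u} R} (g : M ⟶ N)
    (x : (localCohomology a n).obj (ModuleCat.of R R) ⊗[R] M) :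
    (localCohomology a n).map g (tensorMap a n M x) =
      tensorMap a n N (g.hom.lTensor _ x) := by
  induction x with
  | zero => simp
  | add x y hx hy => simp only [map_add, hx, hy]
  | tmul z m =>
    rw [LinearMap.lTensor_tmul, tensorMap_tmul, tensorMap_tmul]
    refine (ConcreteCategory.congr_hom ((localCohomology a n).map_comp _ g) z).symm.trans ?_
    rw [← ModuleCat.ofHom_hom g, ← ModuleCat.ofHom_comp, LinearMap.comp_toSpanSingleton]

lemma tensorMap_self (x : (localCohomology a n).obj (ModuleCat.of R R) ⊗[R] R) :
    tensorMap a n (ModuleCat.of R R) x = TensorProduct.rid R _ x := by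
  induction x with
  | zero => simp
  | add x y hx hy => simp only [map_add, hx, hy]
  | tmul z r =>
    rw [TensorProduct.rid_tmul]
    have h : ModuleCat.ofHom (LinearMap.toSpanSingleton R R r) = r • 𝟙 (ModuleCat.of R R) := by
      ext
      simp
    refine (congr_arg (fun f => (localCohomology a n).map f z) h).trans ?_
    rw [map_smul_apply]
    exact congr_arg (r • ·) (ConcreteCategory.congr_hom ((localCohomology a n).map_id _) z)

variable {ι : Type u}

lemma tensorMap_free_surjective [IsNoetherianRing R] :
    Function.Surjective (tensorMap a n (ModuleCat.of R (ι →₀ R))) := fun z => by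
  obtain ⟨S, hS⟩ := exists_eq_sum_map n z
  refine ⟨∑ s ∈ S, (localCohomology a n).map (freeπ ι s) z ⊗ₜ Finsupp.single s 1, ?_⟩
  rw [map_sum]
  refine Eq.trans (Finset.sum_congr rfl fun s _ => ?_) hS.symm
  refine (tensorMap_tmul _ _).trans (congr_arg (fun f => (localCohomology a n).map f _) ?_)
  ext
  simp

lemma tensorMap_free_injective :
    Function.Injective (tensorMap a n (ModuleCat.of R (ι →₀ R))) := by
  classical
  refine (injective_iff_map_eq_zero _).2 fun x hx => ?_
  refine (TensorProduct.finsuppScalarRight R R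
    ((localCohomology a n).obj (ModuleCat.of R R)) ι).injective ?_
  ext s
  rw [map_zero, TensorProduct.finsuppScalarRight_apply]
  refine (tensorMap_self _).symm.trans ?_
  refine (map_tensorMap (freeπ ι s) x).symm.trans ?_
  rw [hx, map_zero]
  rfl

variable [IsNoetherianRing R]
  (h : ∀ i, n < i → Subsingleton ((localCohomology a i).obj (ModuleCat.of R R)))
include h

lemma tensorMap_surjective (M : ModuleCat.{u} R) :
    Function.Surjective (tensorMap a n M) := fun z => by
  obtain ⟨y, rfl⟩ := map_g_surjective (freeCover_shortExact M) n
    (subsingleton_of_lt _ h _ n.lt_succ_self) z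
  obtain ⟨x, rfl⟩ := tensorMap_free_surjective y
  exact ⟨_, (map_tensorMap _ x).symm⟩

lemma tensorMap_injective (M : ModuleCat.{u} R) :
    Function.Injective (tensorMap a n M) := by
  refine (injective_iff_map_eq_zero _).2 fun x hx => ?_
  obtain ⟨y, rfl⟩ := LinearMap.lTensor_surjective _
    (Finsupp.linearCombination_id_surjective R M) x
  obtain ⟨w, hw⟩ := exact_map (freeCover_shortExact M) n
    (tensorMap a n (freeCover M).X₂ y) ((map_tensorMap _ _).trans hx)
  obtain ⟨v, rfl⟩ := tensorMap_surjective h _ w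
  rw [map_tensorMap] at hw
  rw [← tensorMap_free_injective hw]
  refine (LinearMap.lTensor_comp_apply _ _ _ _).symm.trans ?_
  have : (freeCover M).g.hom ∘ₗ (freeCover M).f.hom = 0 := LinearMap.ext fun x => x.2
  refine (congr_arg (fun g => LinearMap.lTensor _ g v) this).trans ?_
  rw [LinearMap.lTensor_zero, LinearMap.zero_apply]

lemma preservesFiniteColimits : PreservesFiniteColimits (localCohomology a n) := by
  refine ((Functor.preservesFiniteColimits_tfae (localCohomology a n)).out 0 3).1 fun S hS => ?_
  refine ⟨?_, ?_⟩
  · rw [ShortComplex.moduleCat_exact_iff]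
    exact exact_map hS n
  · exact (ModuleCat.epi_iff_surjective _).2
      (map_g_surjective hS n (subsingleton_of_lt _ h _ n.lt_succ_self))

end Tensor
end localCohomology

end

noncomputable section
open CategoryTheory TensorProduct

/-- If `R` is relative Cohen-Macaulay with respect to `a` with
`cd(a,R) = n`, then `H_a^n(R) ⊗_R M ≅ H_a^n(M)` for every finitely generated `M`;
in particular the functor `H_a^n(-)` is right exact. -/
theorem stmt_4 (R : Type u) [CommRing R] [IsNoetherianRing R] [IsLocalRing R]
    (a : Ideal R) (n : ℕ) (hRCM : IsRelativeCMAt R a n (ModuleCat.of R R)) :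
    (∀ M : ModuleCat.{u} R, Module.Finite R ↥M →
      Nonempty ((↥((localCohomology a n).obj (ModuleCat.of R R)) ⊗[R] ↥M) ≃ₗ[R]
        ↥((localCohomology a n).obj M))) ∧
    Nonempty (CategoryTheory.Limits.PreservesFiniteColimits (localCohomology a n)) := by
  have h := fun i (hi : n < i) => hRCM.2 i hi.ne'
  exact ⟨fun M _ => ⟨.ofBijective (localCohomology.tensorMap a n M)
    ⟨localCohomology.tensorMap_injective h M, localCohomology.tensorMap_surjective h M⟩⟩,
    ⟨localCohomology.preservesFiniteColimits h⟩⟩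

end
end
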